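/- Let n ≥ 4 be an integer and let Γ be a finite-index subgroup of SL_n(ℤ). Then there is no injective group homomorphism from Γ into the Cremona group Bir(ℙ²), identified with the group of ℂ-algebra automorphisms of the field ℂ(x,y). -/

import Mathlib

open MvPolynomial

noncomputable section

/-- The field `ℂ(x,y)` of rational functions in two variables. -/
abbrev K2 : Type := FractionRing (MvPolynomial (Fin 2) ℂ)

/-- The Cremona group, identified with the group of `ℂ`-algebra automorphisms
of `ℂ(x,y)`. -/
abbrev Cremona : Type := K2 ≃ₐ[ℂ] K2

lemma exists_prime_dvd_eval (f : Polynomial ℤ) (hf : 0 < f.natDegree) (N : ℕ) :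
    ∃ p : ℕ, p.Prime ∧ N < p ∧ ∃ n : ℤ, (p : ℤ) ∣ f.eval n := by
  by_cases h0 : f.eval 0 = 0
  · obtain ⟨p, hp, hpp⟩ := Nat.exists_infinite_primes (N + 1)
    exact ⟨p, hpp, hp, 0, by rw [h0]; exact dvd_zero _⟩
  set c := f.eval 0 with hc
  -- values at multiples of `c * N!`
  have key : ∀ x : ℤ, ∃ y : ℤ, f.eval (c * N.factorial * x) = c * (1 + N.factorial * y) := by
    intro x
    have := Polynomial.sub_dvd_eval_sub (c * N.factorial * x) 0 f
    obtain ⟨y, hy⟩ := this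
    exact ⟨x * y, by linear_combination hy⟩
  have hfin : ∀ v : ℤ, {x : ℤ | f.eval x = v}.Finite := by
    intro v
    have hne : f - Polynomial.C v ≠ 0 := by
      intro h
      have : f = Polynomial.C v := sub_eq_zero.mp h
      rw [this] at hf
      simp at hf
    refine ((f - Polynomial.C v).roots.toFinset.finite_toSet).subset ?_
    intro x hx
    have hx' : f.eval x = v := hx
    rw [Finset.mem_coe, Multiset.mem_toFinset, Polynomial.mem_roots hne]
    simp [Polynomial.IsRoot, hx'] 
  have hinf : ∃ x : ℤ, f.eval (c * N.factorial * x) ≠ c ∧ f.eval (c * N.factorial * x) ≠ -c := by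
    by_contra hcon
    push Not at hcon
    have hinj : Function.Injective (fun x : ℤ => c * N.factorial * x) := by
      intro x y hxy
      have h1 : (c * N.factorial : ℤ) ≠ 0 :=
        mul_ne_zero h0 (by exact_mod_cast Nat.factorial_ne_zero N)
      exact mul_left_cancel₀ h1 hxy
    have : (Set.univ : Set ℤ) ⊆ (fun x : ℤ => c * N.factorial * x) ⁻¹'
        ({x : ℤ | f.eval x = c} ∪ {x : ℤ | f.eval x = -c}) := by
      intro x _
      by_cases h : f.eval (c * N.factorial * x) = c
      · left; exact h
      · right; exact hcon x h
    exact Set.infinite_univ ((((hfin c).union (hfin (-c))).preimage hinj.injOn).subset this)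
  obtain ⟨x, hx1, hx2⟩ := hinf
  obtain ⟨y, hy⟩ := key x
  have hna : (1 + N.factorial * y : ℤ).natAbs ≠ 1 := by
    intro h
    rcases Int.natAbs_eq_iff.mp h with h | h
    · apply hx1; rw [hy, h]; simp
    · apply hx2; rw [hy, h]; simp
  obtain ⟨p, hp, hpd⟩ := Nat.exists_prime_and_dvd hna
  have hpd' : (p : ℤ) ∣ 1 + N.factorial * y := Int.natCast_dvd.mpr hpd
  refine ⟨p, hp, ?_, c * N.factorial * x, ?_⟩
  · by_contra hle
    push Not at hle
    have : (p : ℤ) ∣ N.factorial := by exact_mod_cast (hp.dvd_factorial).mpr hle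
    have h1 : (p : ℤ) ∣ 1 := by
      have := (dvd_add_left (this.mul_right y)).mp hpd'
      exact this
    exact hp.one_lt.ne' (by exact_mod_cast Int.eq_one_of_dvd_one (by positivity) h1)
  · rw [hy]; exact hpd'.mul_left c

lemma padicInt_uncountable (p : ℕ) [Fact p.Prime] : ¬ Countable ℤ_[p] := by
  intro h
  have h2 : Countable ℚ_[p] := by
    have : Function.Surjective (fun x : ℤ_[p] × ℤ_[p] => (x.1 : ℚ_[p]) / x.2) := by
      intro z
      obtain ⟨x, y, hy, rfl⟩ := IsFractionRing.div_surjective (A := ℤ_[p]) z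
      exact ⟨(x, y), rfl⟩
    exact this.countable
  have h3 := continuum_le_cardinal_of_nontriviallyNormedField ℚ_[p]
  have h4 := Cardinal.mk_le_aleph0_iff.mpr h2
  exact absurd (h3.trans h4) (not_le.mpr Cardinal.aleph0_lt_continuum)

lemma padic_alg_indep (p : ℕ) [Fact p.Prime] {ι : Type} [Finite ι] (a : ι → ℤ) :
    ∃ τ : ι → ℤ_[p], AlgebraicIndependent ℤ (fun i => (a i : ℤ_[p]) + p * τ i) := by
  obtain ⟨s, hs⟩ := exists_isTranscendenceBasis ℤ ℤ_[p]
  have hinf : s.Infinite := by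
    intro hfin
    apply padicInt_uncountable p
    have : Finite s := hfin
    have h1 := hs.isAlgebraic
    have h2 := Algebra.IsAlgebraic.cardinalMk_le_max (Algebra.adjoin ℤ (Set.range ((↑) : s → ℤ_[p]))) ℤ_[p]
    have h3 : Countable (Algebra.adjoin ℤ (Set.range ((↑) : s → ℤ_[p]))) := by
      have : Countable (MvPolynomial s ℤ) := by
        rw [← Cardinal.mk_le_aleph0_iff]
        refine MvPolynomial.cardinalMk_le_max.trans ?_
        simp
      exact hs.1.aevalEquiv.symm.injective.countable
    rw [← Cardinal.mk_le_aleph0_iff] at h3 ⊢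
    exact h2.trans (max_le h3 le_rfl)
  have := hinf.to_subtype
  obtain ⟨e⟩ : Nonempty (ι ↪ s) := by
    have := Fintype.ofFinite ι
    exact ⟨(Fintype.equivFin ι).toEmbedding.trans (Fin.valEmbedding.trans (Infinite.natEmbedding s))⟩
  refine ⟨fun i => e i, ?_⟩
  have h1 : AlgebraicIndependent ℤ (fun i => ((e i : s) : ℤ_[p])) := hs.1.comp e e.injective
  have h2 := h1.polynomial_aeval_of_transcendental
    (f := fun i => Polynomial.C (a i) + Polynomial.C (p : ℤ) * Polynomial.X) (fun i => by
      have hp0 : (p : ℤ) ≠ 0 := by exact_mod_cast (Fact.out : p.Prime).ne_zero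
      have hd : (Polynomial.C (a i) + Polynomial.C (p : ℤ) * Polynomial.X).natDegree = 1 := by
        rw [add_comm]; exact Polynomial.natDegree_linear hp0
      apply Polynomial.transcendental
      · rw [hd]; exact one_ne_zero
      · apply mem_nonZeroDivisors_of_ne_zero
        rw [Polynomial.leadingCoeff_ne_zero]
        intro h
        rw [h] at hd
        simp at hd)
  convert h2 using 2 with i
  simp

lemma cassels_core {ι : Type} [Finite ι] (g : MvPolynomial ι ℤ) (hg : g ≠ 0)
    (F U V : Polynomial (MvPolynomial ι ℤ)) (hdeg : 0 < F.natDegree) (hlead : F.leadingCoeff = g)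
    (hbez : U * F + V * Polynomial.derivative F = Polynomial.C (g ^ 2)) (N : ℕ) :
    ∃ (p : ℕ) (_ : Fact p.Prime), N < p ∧ ∃ ψ : MvPolynomial ι ℤ →+* ℤ_[p],
      Function.Injective ψ ∧ IsUnit (ψ g) ∧ ∃ θ : ℤ_[p], F.eval₂ ψ θ = 0 := by
  obtain ⟨a, ha⟩ : ∃ a : ι → ℤ, eval a g ≠ 0 := by
    by_contra hcon
    push Not at hcon
    exact hg (MvPolynomial.funext fun x => by simp [hcon x])
  set Fa : Polynomial ℤ := F.map (eval a) with hFa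
  have hFadeg : 0 < Fa.natDegree := by
    rw [hFa, Polynomial.natDegree_map_of_leadingCoeff_ne_zero _ (by rw [hlead]; exact ha)]
    exact hdeg
  obtain ⟨p, hp, hNp, n, hn⟩ := exists_prime_dvd_eval Fa hFadeg (N + (eval a g).natAbs)
  have : Fact p.Prime := ⟨hp⟩
  obtain ⟨τ, hτ⟩ := padic_alg_indep p a
  set ψ : MvPolynomial ι ℤ →+* ℤ_[p] :=
    (aeval (fun i => (a i : ℤ_[p]) + p * τ i) : MvPolynomial ι ℤ →ₐ[ℤ] ℤ_[p]).toRingHom with hψ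
  -- reduction
  have hred : (PadicInt.toZMod (p := p)).comp ψ = (Int.castRingHom (ZMod p)).comp (eval a) := by
    apply MvPolynomial.ringHom_ext
    · intro r; simp [hψ]
    · intro i; simp [hψ]
  have hred' : ∀ x, PadicInt.toZMod (ψ x) = ((eval a x : ℤ) : ZMod p) := fun x =>
    congrArg (fun f => f x) hred
  have hunit : ∀ z : ℤ_[p], PadicInt.toZMod z ≠ 0 → IsUnit z := by
    intro z hz
    by_contra hcon
    apply hz
    rw [← RingHom.mem_ker, PadicInt.ker_toZMod]
    exact hcon
  have hgu : IsUnit (ψ g) := by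
    apply hunit
    rw [hred', Ne, ZMod.intCast_zmod_eq_zero_iff_dvd]
    intro hd
    have := Int.natCast_dvd.mp hd
    have := Nat.le_of_dvd (Int.natAbs_pos.mpr ha) this
    omega
  have hFn : PadicInt.toZMod (F.eval₂ ψ (n : ℤ_[p])) = 0 := by
    rw [Polynomial.hom_eval₂, hred]
    have h1 : Polynomial.eval₂ ((Int.castRingHom (ZMod p)).comp (eval a)) (PadicInt.toZMod (n : ℤ_[p])) F
        = ((Fa.eval n : ℤ) : ZMod p) := by
      rw [map_intCast, ← Polynomial.eval₂_map, ← hFa]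
      exact (Polynomial.eval₂_at_intCast (Int.castRingHom (ZMod p)) n)
    rw [h1, ZMod.intCast_zmod_eq_zero_iff_dvd]
    exact hn
  have hFn' : IsUnit ((Polynomial.derivative F).eval₂ ψ (n : ℤ_[p])) := by
    apply hunit
    intro h0
    have h1 := congrArg (fun P => PadicInt.toZMod (Polynomial.eval₂ ψ (n : ℤ_[p]) P)) hbez
    simp only [Polynomial.eval₂_add, Polynomial.eval₂_mul, map_add, map_mul, hFn, h0, mul_zero,
      Polynomial.eval₂_C, add_zero] at h1
    exact ((hgu.map PadicInt.toZMod).pow 2).ne_zero (by rw [← map_pow, ← map_pow, ← h1])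
  refine ⟨p, this, by omega, ψ, ?_, hgu, ?_⟩
  · exact hτ
  · have hnorm : ‖(F.map ψ).aeval (n : ℤ_[p])‖ < ‖(F.map ψ).derivative.aeval (n : ℤ_[p])‖ ^ 2 := by
      simp only [Polynomial.derivative_map, Polynomial.coe_aeval_eq_eval, Polynomial.eval_map]
      rw [PadicInt.isUnit_iff.mp hFn', one_pow]
      rw [← PadicInt.mem_nonunits]
      rw [← RingHom.mem_ker, PadicInt.ker_toZMod] at hFn
      exact hFn
    obtain ⟨z, hz, -⟩ := hensels_lemma hnorm
    exact ⟨z, by simpa [Polynomial.eval_map] using hz⟩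

lemma clear_denoms {A F : Type} [CommRing A] [IsDomain A] [Field F] [Algebra A F] [IsFractionRing A F]
    (T : Finset (Polynomial F)) : ∃ g : A, g ≠ 0 ∧ ∀ P ∈ T, ∃ P1 : Polynomial A,
      P1.map (algebraMap A F) = Polynomial.C (algebraMap A F g) * P := by
  classical
  induction T using Finset.induction_on with
  | empty => exact ⟨1, one_ne_zero, by simp⟩
  | insert P T _ ih =>
    obtain ⟨g, hg, h⟩ := ih
    obtain ⟨b, hb, hb'⟩ := IsLocalization.integerNormalization_spec (nonZeroDivisors A) P
    refine ⟨g * b, mul_ne_zero hg (nonZeroDivisors.ne_zero hb), ?_⟩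
    intro Q hQ
    rcases Finset.mem_insert.mp hQ with rfl | hQ
    · refine ⟨Polynomial.C g * IsLocalization.integerNormalization (nonZeroDivisors A) Q, ?_⟩
      rw [Polynomial.map_mul, hb', Polynomial.map_C, map_mul, Polynomial.C_mul, mul_assoc,
        Algebra.smul_def]
      rfl
    · obtain ⟨P1, h1⟩ := h Q hQ
      refine ⟨Polynomial.C b * P1, ?_⟩
      rw [Polynomial.map_mul, h1, Polynomial.map_C, map_mul, Polynomial.C_mul]
      ring

lemma cassels_ext {ι : Type} [Finite ι] {E : Type} [Field E] [Algebra (FractionRing (MvPolynomial ι ℤ)) E]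
    [FiniteDimensional (FractionRing (MvPolynomial ι ℤ)) E] (S : Finset E) (N : ℕ) :
    ∃ (p : ℕ) (_ : Fact p.Prime), N < p ∧ ∃ φ : E →+* ℚ_[p], ∀ s ∈ S, ‖φ s‖ ≤ 1 := by
  classical
  set A := MvPolynomial ι ℤ with hA
  set F0 := FractionRing A with hF0
  have : CharZero A := inferInstance
  have : CharZero F0 := charZero_of_injective_algebraMap (IsFractionRing.injective A F0)
  let pb := Field.powerBasisOfFiniteOfSeparable F0 E
  have hint : IsIntegral F0 pb.gen := Algebra.IsIntegral.isIntegral _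
  set F := minpoly F0 pb.gen with hF
  have hsep : F.Separable := Algebra.IsSeparable.isSeparable F0 pb.gen
  obtain ⟨U, V, hUV⟩ := hsep
  have hG : ∀ s : E, ∃ f : Polynomial F0, s = Polynomial.aeval pb.gen f := fun s =>
    pb.exists_eq_aeval' s
  choose G hG using hG
  obtain ⟨g, hg, hT⟩ := clear_denoms (A := A) (F := F0) ({F, U, V} ∪ S.image G)
  obtain ⟨F1, hF1⟩ := hT F (by simp)
  obtain ⟨U1, hU1⟩ := hT U (by simp)
  obtain ⟨V1, hV1⟩ := hT V (by simp)
  have hinj := IsFractionRing.injective A F0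
  have hg0 : algebraMap A F0 g ≠ 0 := fun h => hg (hinj (by simpa using h))
  have hmonic : F.Monic := minpoly.monic hint
  have hdegF : F1.natDegree = F.natDegree := by
    rw [← Polynomial.natDegree_map_eq_of_injective hinj, hF1, Polynomial.natDegree_C_mul hg0]
  have hlead : F1.leadingCoeff = g := by
    apply hinj
    rw [← Polynomial.leadingCoeff_map_of_injective hinj, hF1]
    simp [hmonic]
  have hbez : U1 * F1 + V1 * Polynomial.derivative F1 = Polynomial.C (g ^ 2) := by
    apply Polynomial.map_injective _ hinj
    simp only [Polynomial.map_add, Polynomial.map_mul, ← Polynomial.derivative_map, hF1, hU1, hV1,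
      Polynomial.derivative_C_mul, Polynomial.map_C, Polynomial.C_pow, Polynomial.map_pow]
    linear_combination (Polynomial.C ((algebraMap A F0) g)) ^ 2 * hUV
  obtain ⟨p, hp, hNp, ψ, hψ, hgu, θ, hθ⟩ := cassels_core g hg F1 U1 V1
    (by rw [hdegF]; exact minpoly.natDegree_pos hint) hlead hbez N
  refine ⟨p, hp, hNp, ?_⟩
  let ψ' : A →+* ℚ_[p] := (algebraMap ℤ_[p] ℚ_[p]).comp ψ
  have hψ' : Function.Injective ψ' := (IsFractionRing.injective ℤ_[p] ℚ_[p]).comp hψ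
  let Ψ : F0 →+* ℚ_[p] := IsFractionRing.lift hψ'
  have hΨ : Ψ.comp (algebraMap A F0) = ψ' := by
    refine RingHom.ext fun x => ?_
    simp [Ψ]
  let _ : Algebra F0 ℚ_[p] := Ψ.toAlgebra
  have hgΨ : Ψ (algebraMap A F0 g) = (ψ g : ℚ_[p]) := congrArg (fun f => f g) hΨ
  have hgne : Ψ (algebraMap A F0 g) ≠ 0 := fun h => hg0 (by simpa using h)
  have key : ∀ (P : Polynomial F0) (P1 : Polynomial A), P1.map (algebraMap A F0) =
      Polynomial.C (algebraMap A F0 g) * P →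
      Ψ (algebraMap A F0 g) * Polynomial.aeval (θ : ℚ_[p]) P = ((P1.eval₂ ψ θ : ℤ_[p]) : ℚ_[p]) := by
    intro P P1 h
    have h1 := congrArg (Polynomial.eval₂ Ψ (θ : ℚ_[p])) h
    rw [Polynomial.eval₂_mul, Polynomial.eval₂_C, Polynomial.eval₂_map, hΨ] at h1
    rw [Polynomial.aeval_def]
    refine h1.symm.trans ?_
    exact (Polynomial.hom_eval₂ P1 ψ (algebraMap ℤ_[p] ℚ_[p]) θ).symm
  have hroot : Polynomial.aeval (θ : ℚ_[p]) (minpoly F0 pb.gen) = 0 := by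
    have := key F F1 hF1
    rw [hθ] at this
    simpa [hgne] using this
  let φ : E →ₐ[F0] ℚ_[p] := pb.lift (θ : ℚ_[p]) hroot
  refine ⟨φ.toRingHom, ?_⟩
  intro s hs
  obtain ⟨P1, hP1⟩ := hT (G s) (Finset.mem_union_right _ (Finset.mem_image_of_mem _ hs))
  have h1 := key _ _ hP1
  have h2 : φ s = Polynomial.aeval (θ : ℚ_[p]) (G s) := by
    conv_lhs => rw [hG s]
    exact pb.lift_aeval _ hroot _
  change ‖φ s‖ ≤ 1
  rw [h2]
  have h3 := congrArg norm h1
  rw [norm_mul, hgΨ] at h3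
  have h4 : ‖((ψ g : ℤ_[p]) : ℚ_[p])‖ = 1 := PadicInt.isUnit_iff.mp hgu
  rw [h4, one_mul] at h3
  rw [h3]
  exact PadicInt.norm_le_one _

lemma cassels_complex (S : Finset ℂ) (N : ℕ) :
    ∃ (p : ℕ) (_ : Fact p.Prime), N < p ∧ ∃ (E : Subfield ℂ) (φ : E →+* ℚ_[p]),
      ∀ s ∈ S, ∃ h : s ∈ E, ‖φ ⟨s, h⟩‖ ≤ 1 := by
  classical
  obtain ⟨I, hI⟩ := (AlgebraicIndependent.matroid ℤ ℂ).exists_isBasis (S : Set ℂ)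
    (by simp)
  rw [AlgebraicIndependent.matroid_isBasis_iff] at hI
  obtain ⟨h1, h2, h3⟩ := hI
  have hfin : Finite I := (S.finite_toSet.subset h2)
  have hai : AlgebraicIndependent ℤ (Subtype.val : I → ℂ) := h1
  have hr : Set.range (Subtype.val : I → ℂ) = I := Subtype.range_val
  rw [← hr] at h3
  let A := MvPolynomial I ℤ
  let F0 := FractionRing A
  let Ψ : F0 →+* ℂ := IsFractionRing.lift (g := (aeval (Subtype.val : I → ℂ) : A →ₐ[ℤ] ℂ).toRingHom) hai
  let _ : Algebra F0 ℂ := Ψ.toAlgebra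
  have halg : ∀ s ∈ S, IsAlgebraic F0 s := by
    intro s hs
    refine (h3 s hs).ringHom_of_comp_eq ((algebraMap A F0).comp hai.aevalEquiv.symm.toRingEquiv.toRingHom) (RingHom.id ℂ) ?_ ?_
    · exact (IsFractionRing.injective A F0).comp hai.aevalEquiv.symm.injective
    · refine RingHom.ext fun x => ?_
      obtain ⟨y, rfl⟩ := hai.aevalEquiv.surjective x
      change Ψ (algebraMap A F0 (hai.aevalEquiv.symm (hai.aevalEquiv y))) = _
      rw [AlgEquiv.symm_apply_apply]
      exact IsFractionRing.lift_algebraMap (g := (aeval (Subtype.val : I → ℂ) : A →ₐ[ℤ] ℂ).toRingHom) hai y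
  let E := IntermediateField.adjoin F0 (S : Set ℂ)
  have hfd : FiniteDimensional F0 E :=
    IntermediateField.finiteDimensional_adjoin fun x hx => (halg x hx).isIntegral
  obtain ⟨p, hp, hN, φ, hφ⟩ := cassels_ext (ι := I) (E := E)
    (S.attach.image fun s : S => (⟨s.1, IntermediateField.subset_adjoin F0 _ s.2⟩ : E)) N
  refine ⟨p, hp, hN, E.toSubfield, φ, fun s hs => ⟨IntermediateField.subset_adjoin F0 _ hs, ?_⟩⟩
  exact hφ _ (Finset.mem_image.mpr ⟨⟨s, hs⟩, by simp, rfl⟩)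

lemma cassels (S : Finset ℂ) (N : ℕ) :
    ∃ (p : ℕ) (_ : Fact p.Prime), N < p ∧ ∃ (O : Subring ℂ) (r : O →+* ZMod p),
      (∀ s ∈ S, s ∈ O) ∧ (∀ z : O, r z = 0 → ∃ w : O, z = p * w) ∧
      (∀ z : O, (∀ k : ℕ, ∃ w : O, z = p ^ k * w) → z = 0) := by
  obtain ⟨p, hp, hN, E, φ, h⟩ := cassels_complex S N
  refine ⟨p, hp, hN, ?_⟩
  let O' : Subring E := (PadicInt.subring p).comap φ
  let O : Subring ℂ := O'.map E.subtype
  have hO : ∀ z : O, ∃ h : z.1 ∈ E, ‖φ ⟨z.1, h⟩‖ ≤ 1 := by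
    rintro ⟨z, ⟨w, hw, rfl⟩⟩
    exact ⟨w.2, hw⟩
  let i : O →+* E := 
    { toFun := fun z => ⟨z.1, (hO z).1⟩
      map_one' := rfl
      map_mul' := fun _ _ => rfl
      map_zero' := rfl
      map_add' := fun _ _ => rfl }
  have hi : ∀ z, φ (i z) ∈ PadicInt.subring p := fun z => (hO z).2
  let π : O →+* ℤ_[p] := (φ.comp i).codRestrict (PadicInt.subring p) hi
  have hπi : Function.Injective π := by
    intro x y hxy
    have : φ (i x) = φ (i y) := congrArg Subtype.val hxy
    have := φ.injective this
    exact Subtype.ext (congrArg (Subtype.val : E → ℂ) this)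
  refine ⟨O, (PadicInt.toZMod).comp π, ?_, ?_, ?_⟩
  · intro s hs
    obtain ⟨h1, h2⟩ := h s hs
    exact ⟨⟨s, h1⟩, h2, rfl⟩
  · intro z hz
    have hz' : π z ∈ RingHom.ker (PadicInt.toZMod (p := p)) := hz
    rw [PadicInt.ker_toZMod, PadicInt.maximalIdeal_eq_span_p, Ideal.mem_span_singleton] at hz'
    obtain ⟨w, hw⟩ := hz'
    have hpE : (p : E) ≠ 0 := by exact_mod_cast hp.out.ne_zero
    have hpQ : (p : ℚ_[p]) ≠ 0 := by exact_mod_cast hp.out.ne_zero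
    have hw' : φ (i z) = p * (w : ℚ_[p]) := by
      have := congrArg (Subtype.val) hw
      exact this.trans (by simp)
    refine ⟨⟨((i z / p : E) : ℂ), ⟨i z / p, ?_, rfl⟩⟩, ?_⟩
    · change φ (i z / p) ∈ PadicInt.subring p
      rw [map_div₀, hw', map_natCast, mul_div_cancel_left₀ _ hpQ]
      exact w.2
    · apply Subtype.ext
      have : (i z : E) = p * (i z / p) := by field_simp
      exact congrArg (Subtype.val : E → ℂ) this
  · intro z hz
    apply hπi
    rw [map_zero]
    by_contra hne
    obtain ⟨w, hw⟩ := hz ((π z).valuation + 1)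
    have h1 : π z = p ^ ((π z).valuation + 1) * π w := by
      conv_lhs => rw [hw]
      simp
    have hwne : π w ≠ 0 := fun h0 => hne (by rw [h1, h0, mul_zero])
    have h2 := congrArg PadicInt.valuation h1
    rw [PadicInt.valuation_p_pow_mul _ _ hwne] at h2
    omega

section LocAbs
variable {R k K : Type} [CommRing R] [Field k] [Field K]

/-- `f` is regular at `e` with residue `w`. -/
def Res (j : R →+* K) (e : R →+* k) (f : K) (w : k) : Prop :=
  ∃ N D : R, e D ≠ 0 ∧ f * j D = j N ∧ e N = w * e D

variable {j : R →+* K} (hj : Function.Injective j) {e : R →+* k}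

lemma Res.map (N : R) : Res j e (j N) (e N) := ⟨N, 1, by simp, by simp, by simp⟩

lemma Res.add {f g : K} {v w : k} (h1 : Res j e f v) (h2 : Res j e g w) : Res j e (f + g) (v + w) := by
  obtain ⟨N, D, u1, u2, u3⟩ := h1
  obtain ⟨N', D', h1', h2', h3'⟩ := h2; have h1 := u1; have h2 := u2; have h3 := u3
  refine ⟨N * D' + N' * D, D * D', by simp [h1, h1'], ?_, ?_⟩
  · simp only [map_add, map_mul, ← h2, ← h2']; ring
  · simp only [map_add, map_mul, h3, h3']; ring

lemma Res.mul {f g : K} {v w : k} (h1 : Res j e f v) (h2 : Res j e g w) : Res j e (f * g) (v * w) := by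
  obtain ⟨N, D, u1, u2, u3⟩ := h1
  obtain ⟨N', D', h1', h2', h3'⟩ := h2; have h1 := u1; have h2 := u2; have h3 := u3
  refine ⟨N * N', D * D', by simp [h1, h1'], ?_, ?_⟩
  · simp only [map_mul, ← h2, ← h2']; ring
  · simp only [map_mul, h3, h3']; ring

lemma Res.one : Res j e 1 1 := by simpa using Res.map (j := j) (e := e) 1
lemma Res.zero : Res j e 0 0 := by simpa using Res.map (j := j) (e := e) 0
lemma Res.neg {f : K} {v : k} (h1 : Res j e f v) : Res j e (-f) (-v) := by
  simpa using (Res.map (j := j) (e := e) (-1)).mul h1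
lemma Res.sub {f g : K} {v w : k} (h1 : Res j e f v) (h2 : Res j e g w) : Res j e (f - g) (v - w) := by
  simpa [sub_eq_add_neg] using h1.add h2.neg

include hj in
lemma Res.inv {f : K} {v : k} (h1 : Res j e f v) (hv : v ≠ 0) : Res j e f⁻¹ v⁻¹ := by
  obtain ⟨N, D, h1, h2, h3⟩ := h1
  have hD : j D ≠ 0 := fun h => h1 (by rw [hj (h.trans (map_zero j).symm), map_zero])
  have hN : e N ≠ 0 := by rw [h3]; exact mul_ne_zero hv h1
  have hN' : j N ≠ 0 := fun h => hN (by rw [hj (h.trans (map_zero j).symm), map_zero])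
  have hf : f ≠ 0 := by rintro rfl; exact hN' (by rw [← h2, zero_mul])
  refine ⟨D, N, hN, ?_, ?_⟩
  · rw [← h2]; field_simp
  · rw [h3]; field_simp

include hj in
lemma Res.unique {f : K} {v w : k} (h1 : Res j e f v) (h2 : Res j e f w) : v = w := by
  obtain ⟨N, D, u1, u2, u3⟩ := h1
  obtain ⟨N', D', h1', h2', h3'⟩ := h2; have h1 := u1; have h2 := u2; have h3 := u3
  have : N * D' = N' * D := by
    apply hj
    simp only [map_mul, ← h2, ← h2']; ring
  have h := congrArg e this
  simp only [map_mul, h3, h3'] at h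
  have hd : e D * e D' ≠ 0 := mul_ne_zero h1 h1'
  apply mul_right_cancel₀ hd
  linear_combination h

variable (j e) in
/-- The local ring. -/
def Loc : Subring K where
  carrier := {f | ∃ w, Res j e f w}
  mul_mem' := fun ⟨_, h⟩ ⟨_, h'⟩ => ⟨_, h.mul h'⟩
  one_mem' := ⟨_, Res.one⟩
  add_mem' := fun ⟨_, h⟩ ⟨_, h'⟩ => ⟨_, h.add h'⟩
  zero_mem' := ⟨_, Res.zero⟩
  neg_mem' := fun ⟨_, h⟩ => ⟨_, h.neg⟩

lemma Res.mem {f : K} {v : k} (h1 : Res j e f v) : f ∈ Loc j e := ⟨v, h1⟩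
lemma mem_Loc {f : K} : f ∈ Loc j e ↔ ∃ w, Res j e f w := Iff.rfl

include hj in
lemma res_zero_iff {f : K} : Res j e f 0 ↔ f ∈ Loc j e ∧ (f = 0 ∨ f⁻¹ ∉ Loc j e) := by
  constructor
  · intro h
    refine ⟨h.mem, ?_⟩
    by_cases hf : f = 0
    · exact Or.inl hf
    right
    rintro ⟨w, hw⟩
    have h2 := h.mul hw
    rw [mul_inv_cancel₀ hf, zero_mul] at h2
    exact one_ne_zero (Res.one.unique hj h2)
  · rintro ⟨⟨w, hw⟩, h⟩
    rcases h with rfl | h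
    · exact Res.zero
    · by_cases h0 : w = 0
      · rwa [h0] at hw
      · exact absurd (hw.inv hj h0).mem h

/-- transport of residues along a field map -/
lemma Res.transport (hj : Function.Injective j) {R' : Type} [CommRing R'] {j' : R' →+* K} {e' : R' →+* k} (g : K →+* K)
    (h : ∀ N, Res j e (g (j' N)) (e' N)) {f : K} {w : k} (hf : Res j' e' f w) : Res j e (g f) w := by
  obtain ⟨N, D, h1, h2, h3⟩ := hf
  have hD := h D
  have hN := h N
  have h4 := hN.mul (hD.inv hj h1)
  have hD0 : g (j' D) ≠ 0 := by
    intro h0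
    rw [h0] at hD
    exact h1 (hD.unique hj Res.zero)
  have h5 : g (j' N) * (g (j' D))⁻¹ = g f := by rw [← h2, map_mul]; field_simp
  rw [h5, h3] at h4
  convert h4 using 1
  field_simp

end LocAbs

section PartB2
open Pointwise
variable {p : ℕ} [Fact p.Prime] {O : Subring ℂ} (r : O →+* ZMod p)

variable (O) in
/-- embedding of `O[x,y]` in `ℂ(x,y)` -/
def jO : MvPolynomial (Fin 2) O →+* K2 :=
  (algebraMap (MvPolynomial (Fin 2) ℂ) K2).comp (MvPolynomial.map O.subtype)

/-- evaluation mod `p` -/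
def evb (b : Fin 2 → ZMod p) : MvPolynomial (Fin 2) O →+* ZMod p := eval₂Hom r b

lemma jO_inj : Function.Injective (jO O) :=
  (IsFractionRing.injective (MvPolynomial (Fin 2) ℂ) K2).comp
    (MvPolynomial.map_injective _ Subtype.val_injective)

lemma jO_C (c : O) : jO O (C c) = algebraMap ℂ K2 c := by
  simp only [jO, RingHom.comp_apply, map_C]
  exact (IsScalarTower.algebraMap_apply ℂ (MvPolynomial (Fin 2) ℂ) K2 (c : ℂ)).symm

/-- local ring at a point mod `p` -/
def LL (b : Fin 2 → ZMod p) : Subring K2 := Loc (jO O) (evb r b)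

variable {r}

lemma res_X (b : Fin 2 → ZMod p) (i : Fin 2) : Res (jO O) (evb r b) (jO O (X i)) (b i) := by
  simpa [evb] using Res.map (j := jO O) (e := evb r b) (X i)

lemma res_transport (g : Cremona) {a b : Fin 2 → ZMod p}
    (h : ∀ i, Res (jO O) (evb r b) (g (jO O (X i))) (a i)) {f : K2} {w : ZMod p}
    (hf : Res (jO O) (evb r a) f w) : Res (jO O) (evb r b) (g f) w := by
  refine Res.transport jO_inj (g : K2 →+* K2) ?_ hf
  intro N
  induction N using MvPolynomial.induction_on with
  | C c =>
    have : (g : K2 →+* K2) (jO O (C c)) = jO O (C c) := by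
      rw [jO_C]; exact g.commutes _
    rw [this]
    simpa [evb] using Res.map (j := jO O) (e := evb r b) (C c)
  | add P Q hP hQ => rw [map_add, map_add, map_add]; exact hP.add hQ
  | mul_X P i hP =>
    rw [map_mul, map_mul, map_mul]
    refine hP.mul ?_
    simpa [evb] using h i

lemma evb_eq_of (b b' : Fin 2 → ZMod p)
    (h : ∀ f w, Res (jO O) (evb r b') f w → Res (jO O) (evb r b) f w) : b' = b := by
  funext i
  exact (h _ _ (res_X b' i)).unique jO_inj (res_X b i)

lemma good_point (g : Cremona) (P Q P' Q' : Fin 2 → MvPolynomial (Fin 2) O)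
    (H1 H2 : MvPolynomial (Fin 2) O)
    (h1 : ∀ i, g (jO O (X i)) * jO O (Q i) = jO O (P i))
    (h2 : ∀ i, g⁻¹ (jO O (X i)) * jO O (Q' i) = jO O (P' i))
    (h3 : g (jO O (Q' 0 * Q' 1)) * jO O H2 = jO O H1) (b : Fin 2 → ZMod p)
    (hb : ∀ i, evb r b (Q i) ≠ 0) (hb1 : evb r b H1 ≠ 0) :
    ∃ a, g • LL r a = LL r b := by
  let a : Fin 2 → ZMod p := fun i => evb r b (P i) / evb r b (Q i)
  have ha : ∀ i, Res (jO O) (evb r b) (g (jO O (X i))) (a i) := fun i =>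
    ⟨P i, Q i, hb i, h1 i, by simp only [a]; field_simp [hb i]⟩
  have hQ : evb r a (Q' 0 * Q' 1) ≠ 0 := by
    intro h0
    have h4 := (res_transport g ha (Res.map (j := jO O) (e := evb r a) (Q' 0 * Q' 1))).mul
      (Res.map (j := jO O) (e := evb r b) H2)
    rw [h3, h0, zero_mul] at h4
    exact hb1 ((Res.map H1).unique jO_inj h4)
  rw [map_mul] at hQ
  have hQ' : ∀ i, evb r a (Q' i) ≠ 0 := by
    intro i
    fin_cases i
    · exact left_ne_zero_of_mul hQ
    · exact right_ne_zero_of_mul hQ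
  let b' : Fin 2 → ZMod p := fun i => evb r a (P' i) / evb r a (Q' i)
  have hb' : ∀ i, Res (jO O) (evb r a) (g⁻¹ (jO O (X i))) (b' i) := fun i =>
    ⟨P' i, Q' i, hQ' i, h2 i, by simp only [b']; field_simp [hQ' i]⟩
  have hbb : b' = b := by
    apply evb_eq_of
    intro f w hf
    have h5 := res_transport g ha (res_transport g⁻¹ hb' hf)
    have : g (g⁻¹ f) = f := g.apply_symm_apply f
    rwa [this] at h5
  rw [hbb] at hb'
  refine ⟨a, ?_⟩
  ext f
  rw [Subring.mem_pointwise_smul_iff_inv_smul_mem]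
  constructor
  · rintro ⟨w, hw⟩
    have h5 := res_transport g ha hw
    have : g (g⁻¹ • f) = f := g.apply_symm_apply f
    rw [this] at h5
    exact h5.mem
  · rintro ⟨w, hw⟩
    exact (res_transport g⁻¹ hb' hw).mem

lemma LL_inj : Function.Injective (LL r) := by
  -- x_i - lift is a nonunit
  intro b' b h
  funext i
  have h1 : Res (jO O) (evb r b') (jO O (X i - C ((b' i).val : O))) 0 := by
    have := Res.map (j := jO O) (e := evb r b') (X i - C ((b' i).val : O))
    simpa [evb] using this
  rw [res_zero_iff jO_inj] at h1
  change _ ∈ LL r b' ∧ (_ ∨ _ ∉ LL r b') at h1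
  rw [h] at h1
  have h2 := (res_zero_iff jO_inj).mpr h1
  have h3 := (Res.map (j := jO O) (e := evb r b) (X i - C ((b' i).val : O))).unique jO_inj h2
  simp [evb] at h3
  exact (sub_eq_zero.mp h3).symm

lemma exists_lift {P : MvPolynomial (Fin 2) ℂ} (h : ∀ c ∈ P.coeffs, c ∈ O) :
    ∃ P1 : MvPolynomial (Fin 2) O, MvPolynomial.map O.subtype P1 = P := by
  have := (mem_range_map_iff_coeffs_subset (f := O.subtype) (x := P)).mpr (by
    intro c hc
    exact ⟨⟨c, h c hc⟩, rfl⟩)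
  exact this

lemma bad_count (F : MvPolynomial (Fin 2) (ZMod p)) (hF : F ≠ 0) :
    (Finset.univ.filter fun b : Fin 2 → ZMod p => eval b F = 0).card ≤ F.totalDegree * p := by
  have h := schwartz_zippel_totalDegree hF Finset.univ
  have hp : (0 : ℚ≥0) < p := by exact_mod_cast (Fact.out : p.Prime).pos
  simp only [Fintype.piFinset_univ, Finset.card_univ, ZMod.card] at h
  rw [div_le_div_iff₀ (by positivity) hp] at h
  have h2 : ((Finset.univ.filter fun b : Fin 2 → ZMod p => eval b F = 0).card : ℚ≥0) ≤ F.totalDegree * p := by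
    have h3 : ((Finset.univ.filter fun b : Fin 2 → ZMod p => eval b F = 0).card : ℚ≥0) * p ≤ (F.totalDegree * p) * p := by
      calc _ ≤ _ := h
        _ = _ := by ring
    exact le_of_mul_le_mul_right h3 hp
  exact_mod_cast h2
end PartB2

open Pointwise in
lemma good_exists (g : Cremona) : ∃ (d : ℕ) (S : Finset ℂ), ∀ (p : ℕ) (_ : Fact p.Prime) (O : Subring ℂ)
    (r : O →+* ZMod p), (∀ s ∈ S, s ∈ O) →
    ∃ B : Finset (Fin 2 → ZMod p), B.card ≤ d * p ∧ ∀ b ∉ B, ∃ a, g • LL r a = LL r b := by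
  classical
  let ι := algebraMap (MvPolynomial (Fin 2) ℂ) K2
  have hι : Function.Injective ι := IsFractionRing.injective _ _
  have hfrac : ∀ z : K2, ∃ P Q : MvPolynomial (Fin 2) ℂ, Q ≠ 0 ∧ z * ι Q = ι P := by
    intro z
    obtain ⟨P, Q, hQ, h⟩ := IsFractionRing.div_surjective (A := MvPolynomial (Fin 2) ℂ) z
    have hQ0 : Q ≠ 0 := nonZeroDivisors.ne_zero hQ
    refine ⟨P, Q, hQ0, ?_⟩
    have : ι Q ≠ 0 := fun h => hQ0 (hι (by simpa using h))
    rw [← h]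
    exact div_mul_cancel₀ _ this
  choose P Q hQ0 hPQ using hfrac
  let P1 : Fin 2 → MvPolynomial (Fin 2) ℂ := fun i => P (g (ι (X i)))
  let Q1 : Fin 2 → MvPolynomial (Fin 2) ℂ := fun i => Q (g (ι (X i)))
  let P2 : Fin 2 → MvPolynomial (Fin 2) ℂ := fun i => P (g⁻¹ (ι (X i)))
  let Q2 : Fin 2 → MvPolynomial (Fin 2) ℂ := fun i => Q (g⁻¹ (ι (X i)))
  let H1 := P (g (ι (Q2 0 * Q2 1)))
  let H2 := Q (g (ι (Q2 0 * Q2 1)))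
  have hH1 : H1 ≠ 0 := by
    intro h0
    have h := hPQ (g (ι (Q2 0 * Q2 1)))
    change _ = ι H1 at h
    rw [h0, map_zero, mul_eq_zero] at h
    rcases h with h | h
    · rw [map_eq_zero_iff g g.injective] at h
      exact mul_ne_zero (hQ0 _) (hQ0 _) (hι (by simpa using h))
    · exact hQ0 _ (hι (by simpa using h))
  let F := Q1 0 * Q1 1 * H1
  have hF : F ≠ 0 := mul_ne_zero (mul_ne_zero (hQ0 _) (hQ0 _)) hH1
  obtain ⟨m, hm⟩ := ne_zero_iff.mp hF
  refine ⟨F.totalDegree, (Finset.univ.biUnion fun i : Fin 2 => (P1 i).coeffs ∪ (Q1 i).coeffs ∪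
    (P2 i).coeffs ∪ (Q2 i).coeffs) ∪ H1.coeffs ∪ H2.coeffs ∪ {(F.coeff m)⁻¹}, ?_⟩
  intro p hp O r hS
  simp only [Finset.mem_union, Finset.mem_biUnion, Finset.mem_univ, true_and, Finset.mem_singleton] at hS
  have hP1 : ∀ i, ∃ P : MvPolynomial (Fin 2) O, MvPolynomial.map O.subtype P = P1 i := fun i =>
    exists_lift fun c hc => hS c (Or.inl (Or.inl (Or.inl ⟨i, by tauto⟩)))
  have hQ1 : ∀ i, ∃ P : MvPolynomial (Fin 2) O, MvPolynomial.map O.subtype P = Q1 i := fun i =>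
    exists_lift fun c hc => hS c (Or.inl (Or.inl (Or.inl ⟨i, by tauto⟩)))
  have hP2 : ∀ i, ∃ P : MvPolynomial (Fin 2) O, MvPolynomial.map O.subtype P = P2 i := fun i =>
    exists_lift fun c hc => hS c (Or.inl (Or.inl (Or.inl ⟨i, by tauto⟩)))
  have hQ2 : ∀ i, ∃ P : MvPolynomial (Fin 2) O, MvPolynomial.map O.subtype P = Q2 i := fun i =>
    exists_lift fun c hc => hS c (Or.inl (Or.inl (Or.inl ⟨i, by tauto⟩)))
  obtain ⟨H1', hH1'⟩ : ∃ P : MvPolynomial (Fin 2) O, MvPolynomial.map O.subtype P = H1 :=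
    exists_lift fun c hc => hS c (by tauto)
  obtain ⟨H2', hH2'⟩ : ∃ P : MvPolynomial (Fin 2) O, MvPolynomial.map O.subtype P = H2 :=
    exists_lift fun c hc => hS c (by tauto)
  choose P1' hP1 using hP1
  choose Q1' hQ1 using hQ1
  choose P2' hP2 using hP2
  choose Q2' hQ2 using hQ2
  let F' := Q1' 0 * Q1' 1 * H1'
  have hF' : MvPolynomial.map O.subtype F' = F := by simp only [F', F, map_mul, hQ1, hH1']
  let Fr := MvPolynomial.map r F'
  have hFr : Fr ≠ 0 := by
    intro h0
    have h1 : r (F'.coeff m) = 0 := by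
      rw [← coeff_map]; change Fr.coeff m = 0; rw [h0, coeff_zero]
    have h2 : (F'.coeff m) * ⟨(F.coeff m)⁻¹, hS _ (by tauto)⟩ = 1 := by
      apply Subtype.ext
      have : ((F'.coeff m : O) : ℂ) = F.coeff m := by
        rw [← hF', coeff_map]; rfl
      simp only [Subring.coe_mul, this, Subring.coe_one]
      exact mul_inv_cancel₀ hm
    have h3 := congrArg r h2
    rw [map_mul, h1, zero_mul, map_one] at h3
    exact zero_ne_one h3
  refine ⟨Finset.univ.filter fun b => eval b Fr = 0, (bad_count Fr hFr).trans ?_, ?_⟩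
  · gcongr
    refine Finset.sup_mono ?_
    intro k hk
    rw [mem_support_iff] at hk ⊢
    intro h0
    apply hk
    rw [← hF', coeff_map] at h0
    have h1 : F'.coeff k = 0 := Subtype.ext h0
    simp only [Fr, coeff_map, h1, map_zero]
  · intro b hb
    simp only [Finset.mem_filter, Finset.mem_univ, true_and] at hb
    have hev : ∀ N, eval b (MvPolynomial.map r N) = evb r b N := by
      intro N; rw [eval_map]; rfl
    change eval b (MvPolynomial.map r F') ≠ 0 at hb
    rw [hev, map_mul, map_mul] at hb
    have hjX : ∀ i, jO O (X i) = ι (X i) := fun i => by simp [jO, ι]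
    have hjm : ∀ N, jO O N = ι (MvPolynomial.map O.subtype N) := fun _ => rfl
    refine good_point g P1' Q1' P2' Q2' H1' H2' ?_ ?_ ?_ b ?_ ?_
    · intro i
      rw [hjX]
      rw [hjm, hjm, hQ1, hP1]
      exact hPQ _
    · intro i
      rw [hjX]
      rw [hjm, hjm, hQ2, hP2]
      exact hPQ _
    · rw [hjm, hjm, hjm, hH1', hH2', map_mul, hQ2, hQ2]
      exact hPQ _
    · intro i
      fin_cases i
      · exact left_ne_zero_of_mul (left_ne_zero_of_mul hb)
      · exact right_ne_zero_of_mul (left_ne_zero_of_mul hb)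
    · exact right_ne_zero_of_mul hb

section Comb
open Classical
variable {G X : Type} [Group G] [MulAction G X] (A : Finset X)

/-- number of points of `A` leaving `A` -/
def ell (g : G) : ℕ := (A.filter fun a => g • a ∉ A).card

lemma ell_one : ell A (1 : G) = 0 := by
  simp [ell]

lemma ell_mul (g h : G) : ell A (g * h) ≤ ell A g + ell A h := by
  unfold ell
  have h1 : (A.filter fun a => (g * h) • a ∉ A) ⊆
      (A.filter fun a => h • a ∉ A) ∪ (A.filter fun a => h • a ∈ A ∧ g • (h • a) ∉ A) := by
    intro a ha
    simp only [Finset.mem_filter, Finset.mem_union, mul_smul] at ha ⊢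
    tauto
  have h2 : (A.filter fun a => h • a ∈ A ∧ g • (h • a) ∉ A).card ≤ (A.filter fun a => g • a ∉ A).card := by
    refine Finset.card_le_card_of_injOn (fun a => h • a) ?_ ?_
    · intro a ha
      simp only [Finset.coe_filter, Set.mem_ofPred_eq] at ha ⊢
      exact ha.2
    · intro a _ b _ hab
      exact MulAction.injective h hab
  calc _ ≤ _ := Finset.card_le_card h1
    _ ≤ _ := Finset.card_union_le _ _
    _ ≤ _ := by omega

lemma ell_inv (g : G) : ell A g⁻¹ = ell A g := by
  have key : ∀ g : G, (A.filter fun a => g • a ∈ A).card + ell A g = A.card := by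
    intro g
    exact Finset.card_filter_add_card_filter_not _
  have h1 : (A.filter fun a => g • a ∈ A).card = (A.filter fun a => g⁻¹ • a ∈ A).card := by
    refine Finset.card_bij (fun a _ => g • a) ?_ ?_ ?_
    · intro a ha
      simp only [Finset.mem_filter, inv_smul_smul] at ha ⊢
      exact ha.symm
    · intro a _ b _ h; exact MulAction.injective g h
    · intro b hb
      refine ⟨g⁻¹ • b, ?_, by simp⟩
      simp only [Finset.mem_filter, smul_inv_smul] at hb ⊢
      exact hb.symm
  have := key g
  have := key g⁻¹
  omega

lemma ell_pow (g : G) (k : ℕ) : ell A (g ^ k) ≤ k * ell A g := by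
  induction k with
  | zero => simp [ell_one]
  | succ k ih =>
    rw [pow_succ]
    have := ell_mul A (g ^ k) g
    linarith

lemma ell_comm (g h : G) {L : ℕ} (hg : ell A g ≤ L) (hh : ell A h ≤ L) :
    ell A (g * h * g⁻¹ * h⁻¹) ≤ 4 * L := by
  have h1 := ell_mul A (g * h * g⁻¹) h⁻¹
  have h2 := ell_mul A (g * h) g⁻¹
  have h3 := ell_mul A g h
  rw [ell_inv] at h1 h2
  omega

lemma pigeon (U : Finset G) (N B : ℕ) (h : ∀ u ∈ U, ∀ n < N, ell A (u ^ n) ≤ B)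
    (h1 : U.card * (2 * B) < A.card) (h2 : 2 * A.card ≤ N) :
    ∃ a ∈ A, ∀ u ∈ U, ∃ d : ℕ, 0 < d ∧ u ^ d • a = a := by
  have hN : 0 < N := by omega
  let bad : G → X → ℕ := fun u a => ((Finset.range N).filter fun n => u ^ n • a ∉ A).card
  have hsum : ∀ u ∈ U, ∑ a ∈ A, bad u a ≤ N * B := by
    intro u hu
    have : ∑ a ∈ A, bad u a = ∑ n ∈ Finset.range N, ell A (u ^ n) := by
      simp only [bad, ell, Finset.card_filter]
      exact Finset.sum_comm
    rw [this]
    calc _ ≤ ∑ n ∈ Finset.range N, B := Finset.sum_le_sum fun n hn => h u hu n (Finset.mem_range.mp hn)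
      _ = _ := by simp
  have hbad : ∀ u ∈ U, (A.filter fun a => N ≤ 2 * bad u a).card ≤ 2 * B := by
    intro u hu
    have e1 : (A.filter fun a => N ≤ 2 * bad u a).card * N ≤ ∑ a ∈ A.filter (fun a => N ≤ 2 * bad u a), 2 * bad u a := by
      rw [← smul_eq_mul]
      exact Finset.card_nsmul_le_sum _ _ _ fun a ha => (Finset.mem_filter.mp ha).2
    have e2 : ∑ a ∈ A.filter (fun a => N ≤ 2 * bad u a), 2 * bad u a ≤ ∑ a ∈ A, 2 * bad u a :=
      Finset.sum_le_sum_of_subset (Finset.filter_subset _ _)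
    have e2' : ∑ a ∈ A, 2 * bad u a = 2 * ∑ a ∈ A, bad u a := (Finset.mul_sum _ _ _).symm
    have e3 := hsum u hu
    have e4 : (A.filter fun a => N ≤ 2 * bad u a).card * N ≤ (2 * B) * N := by
      calc _ ≤ _ := e1
        _ ≤ _ := e2
        _ = _ := e2'
        _ ≤ 2 * (N * B) := by omega
        _ = _ := by ring
    exact Nat.le_of_mul_le_mul_right e4 hN
  obtain ⟨a, haA, ha⟩ : ∃ a ∈ A, a ∉ U.biUnion fun u => A.filter fun a => N ≤ 2 * bad u a := by
    by_contra hcon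
    push Not at hcon
    have e1 : A.card ≤ (U.biUnion fun u => A.filter fun a => N ≤ 2 * bad u a).card :=
      Finset.card_le_card hcon
    have e2 : (U.biUnion fun u => A.filter fun a => N ≤ 2 * bad u a).card ≤ U.card * (2 * B) :=
      Finset.card_biUnion_le_card_mul _ _ _ hbad
    omega
  refine ⟨a, haA, fun u hu => ?_⟩
  have ha' : 2 * bad u a < N := by
    by_contra hc
    exact ha (Finset.mem_biUnion.mpr ⟨u, hu, Finset.mem_filter.mpr ⟨haA, by omega⟩⟩)
  have hc : ((Finset.range N).filter fun n => u ^ n • a ∈ A).card + bad u a = N := by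
    have := Finset.card_filter_add_card_filter_not (s := Finset.range N) (fun n => u ^ n • a ∈ A)
    rw [Finset.card_range] at this
    exact this
  obtain ⟨n, hn, n', hn', hne, heq⟩ := Finset.exists_ne_map_eq_of_card_lt_of_maps_to
    (s := (Finset.range N).filter fun n => u ^ n • a ∈ A) (t := A) (f := fun n => u ^ n • a) (by omega)
    (fun n hn => (Finset.mem_filter.mp hn).2)
  have main : ∀ n n' : ℕ, n < n' → u ^ n • a = u ^ n' • a → ∃ d : ℕ, 0 < d ∧ u ^ d • a = a := by
    intro n n' hlt heq
    refine ⟨n' - n, by omega, ?_⟩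
    apply MulAction.injective (u ^ n)
    change u ^ n • (u ^ (n' - n) • a) = u ^ n • a
    rw [← mul_smul, ← pow_add, heq]
    congr 2
    omega
  rcases lt_or_gt_of_ne hne with hlt | hlt
  · exact main n n' hlt heq
  · exact main n' n hlt heq.symm

variable {I : Type} (E : I → I → ℤ → G) (m : ℤ)
    (hadd : ∀ i j, i ≠ j → ∀ s t, E i j (s + t) = E i j s * E i j t)
    (hcomm : ∀ i k j, i ≠ k → k ≠ j → i ≠ j → ∀ s t,
      E i k s * E k j t * (E i k s)⁻¹ * (E k j t)⁻¹ = E i j (m * s * t))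
    (hI : ∀ i j : I, ∃ k, i ≠ k ∧ k ≠ j)

include hadd hcomm hI in
lemma two_digit (M : ℤ) (K L : ℕ) (hK : 1 ≤ K)
    (h : ∀ i j, i ≠ j → ∀ n : ℤ, |n| ≤ K → ell A (E i j (M * n)) ≤ L) :
    ∀ i j, i ≠ j → ∀ n : ℤ, |n| ≤ (K ^ 2 : ℕ) → ell A (E i j (m * M ^ 2 * n)) ≤ 8 * L := by
  intro i j hij n hn
  obtain ⟨k, hik, hkj⟩ := hI i j
  have hKpos : (0 : ℤ) < K := by exact_mod_cast hK
  have hdm := Int.mul_ediv_add_emod n K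
  have ht0 := Int.emod_nonneg n hKpos.ne'
  have ht1 := Int.emod_lt_of_pos n hKpos
  have hn' := abs_le.mp hn
  push_cast at hn'
  have hq : |n / K| ≤ K := by
    rw [abs_le]
    constructor
    · by_contra hc
      push Not at hc
      nlinarith
    · by_contra hc
      push Not at hc
      nlinarith
  have ht : |n % K| ≤ K := by rw [abs_of_nonneg ht0]; exact ht1.le
  have e1 : m * M ^ 2 * n = m * (M * (n / K)) * (M * K) + m * (M * (n % K)) * (M * 1) := by
    conv_lhs => rw [← hdm]
    ring
  rw [e1, hadd i j hij, ← hcomm i k j hik hkj hij, ← hcomm i k j hik hkj hij]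
  have c1 := ell_comm A _ _ (h i k hik _ hq) (h k j hkj (K : ℤ) (by simp))
  have c2 := ell_comm A _ _ (h i k hik _ ht) (h k j hkj (1 : ℤ) (by simpa using hK))
  have c3 := ell_mul A (E i k (M * (n / K)) * E k j (M * K) * (E i k (M * (n / K)))⁻¹ * (E k j (M * K))⁻¹)
    (E i k (M * (n % K)) * E k j (M * 1) * (E i k (M * (n % K)))⁻¹ * (E k j (M * 1))⁻¹)
  omega

include hadd in
lemma E_pow (i j : I) (hij : i ≠ j) (t : ℤ) (k : ℕ) : E i j (t * k) = E i j t ^ k := by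
  induction k with
  | zero =>
    have := hadd i j hij 0 0
    simp at this
    simpa using this
  | succ k ih =>
    rw [pow_succ, ← ih, ← hadd i j hij]
    push_cast
    ring_nf

include hadd hcomm hI in
lemma ell_bound (K L : ℕ) (hK : 1 ≤ K) (h : ∀ i j, i ≠ j → ell A (E i j 1) ≤ L) (i j : I) (hij : i ≠ j)
    (n : ℕ) (hn : n ≤ K ^ 4) : ell A ((E i j (m ^ 3)) ^ n) ≤ 64 * (K * L) := by
  have h0 : ∀ i j, i ≠ j → ∀ n : ℤ, |n| ≤ K → ell A (E i j (1 * n)) ≤ K * L := by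
    intro i j hij n hn
    have hnat : ∀ k : ℕ, k ≤ K → ell A (E i j k) ≤ K * L := by
      intro k hk
      have := E_pow E hadd i j hij 1 k
      rw [one_mul] at this
      rw [this]
      exact (ell_pow A _ _).trans (Nat.mul_le_mul hk (h i j hij))
    have hinv : ∀ k : ℤ, E i j (-k) = (E i j k)⁻¹ := by
      intro k
      have h1 := hadd i j hij (-k) k
      have h2 := E_pow E hadd i j hij 0 0
      simp at h2
      rw [neg_add_cancel, h2] at h1
      exact eq_inv_of_mul_eq_one_left h1.symm
    rw [one_mul]
    obtain ⟨k, rfl | rfl⟩ := n.eq_nat_or_neg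
    · exact hnat k (by simpa using hn)
    · rw [hinv, ell_inv]
      exact hnat k (by simpa using hn)
  have h1 := two_digit A E m hadd hcomm hI 1 K (K * L) hK h0
  have h2 := two_digit A E m hadd hcomm hI (m * 1 ^ 2) (K ^ 2) (8 * (K * L)) (Nat.one_le_pow _ _ hK) h1
  have h3 := h2 i j hij n (by simpa [← pow_mul] using (by exact_mod_cast hn : (n : ℤ) ≤ (K : ℤ) ^ 4))
  rw [← E_pow E hadd i j hij]
  refine (le_of_eq ?_).trans (h3.trans (le_of_eq (by ring)))
  congr 2
  ring
end Comb

open Pointwise Classical in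
lemma fixed_point {I : Type} [Finite I] (E : I → I → ℤ → Cremona) (m : ℤ)
    (hadd : ∀ i j, i ≠ j → ∀ s t, E i j (s + t) = E i j s * E i j t)
    (hcomm : ∀ i k j, i ≠ k → k ≠ j → i ≠ j → ∀ s t,
      E i k s * E k j t * (E i k s)⁻¹ * (E k j t)⁻¹ = E i j (m * s * t))
    (hI : ∀ i j : I, ∃ k, i ≠ k ∧ k ≠ j) (T : Finset (I × I)) (hT : T.card ≤ 4) (hT' : ∀ x ∈ T, x.1 ≠ x.2) :
    ∃ (p : ℕ) (_ : Fact p.Prime) (O : Subring ℂ) (r : O →+* ZMod p),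
      (∀ z : O, r z = 0 → ∃ w : O, z = p * w) ∧
      (∀ z : O, (∀ k : ℕ, ∃ w : O, z = p ^ k * w) → z = 0) ∧
      ∃ b, ∀ x ∈ T, ∃ d : ℕ, 0 < d ∧ (E x.1 x.2 (m ^ 3)) ^ d • LL r b = LL r b := by
  have := Fintype.ofFinite I
  choose d S hS using good_exists
  let Cc : ℕ := ∑ i, ∑ j, d (E i j 1)
  let SS : Finset ℂ := Finset.univ.biUnion fun i => Finset.univ.biUnion fun j => S (E i j 1)
  obtain ⟨p, hp, hN, O, r, hO, h1, h2⟩ := cassels SS ((2048 * Cc + 1) ^ 2)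
  refine ⟨p, hp, O, r, h1, h2, ?_⟩
  let A : Finset (Subring K2) := Finset.univ.image (LL r)
  have hA : A.card = p ^ 2 := by
    rw [Finset.card_image_of_injective _ LL_inj]
    simp [ZMod.card]
  have hell : ∀ i j, i ≠ j → ell A (E i j 1) ≤ Cc * p := by
    intro i j hij
    obtain ⟨B, hB, hB'⟩ := hS (E i j 1) p hp O r (by
      intro s hs
      apply hO
      simp only [SS, Finset.mem_biUnion, Finset.mem_univ, true_and]
      exact ⟨i, j, hs⟩)
    have e1 : ell A (E i j 1) ≤ B.card := by
      rw [← ell_inv]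
      unfold ell
      have : (A.filter fun a => (E i j 1)⁻¹ • a ∉ A) ⊆ B.image (LL r) := by
        intro a ha
        simp only [Finset.mem_filter, A, Finset.mem_image, Finset.mem_univ, true_and] at ha
        obtain ⟨⟨b, rfl⟩, hb⟩ := ha
        by_contra hc
        have hbB : b ∉ B := fun h => hc (Finset.mem_image_of_mem _ h)
        obtain ⟨a, ha⟩ := hB' b hbB
        apply hb
        refine ⟨a, ?_⟩
        rw [← ha, inv_smul_smul]
      exact (Finset.card_le_card this).trans Finset.card_image_le
    have e2 : d (E i j 1) ≤ Cc := by
      calc d (E i j 1) ≤ ∑ j, d (E i j 1) :=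
            Finset.single_le_sum (f := fun j => d (E i j 1)) (fun _ _ => Nat.zero_le _) (Finset.mem_univ j)
        _ ≤ Cc := Finset.single_le_sum (f := fun i => ∑ j, d (E i j 1)) (fun _ _ => Nat.zero_le _) (Finset.mem_univ i)
    exact (e1.trans hB).trans (Nat.mul_le_mul_right _ e2)
  set s := Nat.sqrt p with hs
  have hs1 : s * s ≤ p := Nat.sqrt_le p
  have hs2 : p < (s + 1) * (s + 1) := Nat.lt_succ_sqrt p
  have hs3 : 2048 * Cc + 1 ≤ s := by
    rw [hs, Nat.le_sqrt]
    nlinarith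
  let K := 2 * (s + 1)
  have hell2 := ell_bound A E m hadd hcomm hI K (Cc * p) (by omega) hell
  have hp0 : 0 < p := hp.out.pos
  have pig := pigeon A (T.image fun x => E x.1 x.2 (m ^ 3)) (K ^ 4) (64 * (K * (Cc * p)))
  have H1 : ∀ u ∈ T.image (fun x => E x.1 x.2 (m ^ 3)), ∀ n < K ^ 4, ell A (u ^ n) ≤ 64 * (K * (Cc * p)) := by
    intro u hu n hn
    obtain ⟨x, hx, rfl⟩ := Finset.mem_image.mp hu
    exact hell2 _ _ (hT' x hx) n hn.le
  have H2 : (T.image fun x => E x.1 x.2 (m ^ 3)).card * (2 * (64 * (K * (Cc * p)))) < A.card := by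
    have e1 : (T.image fun x => E x.1 x.2 (m ^ 3)).card ≤ 4 := Finset.card_image_le.trans hT
    have e2 : 1024 * Cc * (s + 1) < p := by nlinarith
    calc _ ≤ 4 * (2 * (64 * (K * (Cc * p)))) := Nat.mul_le_mul_right _ e1
      _ = (1024 * Cc * (s + 1)) * p := by simp only [K]; ring
      _ < p * p := Nat.mul_lt_mul_of_pos_right e2 hp0
      _ = A.card := by rw [hA]; ring
  have H3 : 2 * A.card ≤ K ^ 4 := by
    rw [hA]
    have : p ^ 2 ≤ ((s + 1) * (s + 1)) ^ 2 := Nat.pow_le_pow_left hs2.le 2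
    calc 2 * p ^ 2 ≤ 16 * ((s + 1) * (s + 1)) ^ 2 := by omega
      _ = K ^ 4 := by simp only [K]; ring
  obtain ⟨a, haA, ha⟩ : ∃ a ∈ A, ∀ u ∈ T.image fun x => E x.1 x.2 (m ^ 3), ∃ d : ℕ, 0 < d ∧ u ^ d • a = a := pig H1 H2 H3
  simp only [A, Finset.mem_image, Finset.mem_univ, true_and] at haA
  obtain ⟨b, rfl⟩ := haA
  exact ⟨b, fun x hx => ha _ (Finset.mem_image_of_mem _ hx)⟩

section TV
variable {n : ℕ}

lemma smz (i j k l : Fin n) (h : j ≠ k) (s t : ℤ) :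
    Matrix.single i j s * Matrix.single k l t = 0 := Matrix.single_mul_single_of_ne _ _ _ _ h _

/-- elementary matrix in `SL_n(ℤ)` -/
def tv (i j : Fin n) (t : ℤ) : Matrix.SpecialLinearGroup (Fin n) ℤ :=
  if h : i ≠ j then ⟨Matrix.transvection i j t, Matrix.det_transvection_of_ne i j h t⟩ else 1

lemma tv_coe {i j : Fin n} (h : i ≠ j) (t : ℤ) : ((tv i j t : Matrix.SpecialLinearGroup (Fin n) ℤ) : Matrix (Fin n) (Fin n) ℤ) = 
    1 + Matrix.single i j t := by
  simp [tv, h, Matrix.transvection]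

lemma tv_add (i j : Fin n) (h : i ≠ j) (s t : ℤ) : tv i j (s + t) = tv i j s * tv i j t := by
  apply Subtype.ext
  rw [Matrix.SpecialLinearGroup.coe_mul]
  simp only [tv_coe h, Matrix.single_add]
  have := smz i j i j h.symm (s) t
  simp only [add_mul, mul_add, one_mul, mul_one, this]
  abel

lemma tv_zero (i j : Fin n) : tv i j 0 = 1 := by
  by_cases h : i ≠ j
  · apply Subtype.ext; rw [tv_coe h]; simp
  · simp [tv, h]

lemma tv_pow (i j : Fin n) (h : i ≠ j) (t : ℤ) (k : ℕ) : tv i j (k * t) = tv i j t ^ k := by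
  induction k with
  | zero => simp [tv_zero]
  | succ k ih => rw [pow_succ, ← ih, ← tv_add i j h]; push_cast; ring_nf

lemma tv_comm (i j k l : Fin n) (hij : i ≠ j) (hkl : k ≠ l) (hjk : j ≠ k) (hil : i ≠ l) (s t : ℤ) :
    tv i j s * tv k l t = tv k l t * tv i j s := by
  apply Subtype.ext
  simp only [Matrix.SpecialLinearGroup.coe_mul]
  simp only [tv_coe hij, tv_coe hkl]
  have h1 := smz i j k l hjk (s) t
  have h2 := smz k l i j hil.symm (t) s
  simp only [add_mul, mul_add, one_mul, mul_one, h1, h2]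
  abel

lemma tv_commutator (i k j : Fin n) (hik : i ≠ k) (hkj : k ≠ j) (hij : i ≠ j) (s t : ℤ) :
    tv i k s * tv k j t = tv i j (s * t) * tv k j t * tv i k s := by
  apply Subtype.ext
  simp only [Matrix.SpecialLinearGroup.coe_mul]
  simp only [tv_coe hij, tv_coe hkj, tv_coe hik]
  have h1 := Matrix.single_mul_single_same (c := s) i k j t
  have h2 := smz k j i k hij.symm (t) s
  have h3 := smz i j k j hkj.symm (s * t) t
  have h4 := smz i j i k hij.symm (s * t) s
  simp only [add_mul, mul_add, one_mul, mul_one, h1, h2, h3, h4, zero_mul]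
  abel

lemma tv_ne_one (i j : Fin n) (h : i ≠ j) (t : ℤ) (ht : t ≠ 0) : tv i j t ≠ 1 := by
  intro h1
  have := congrArg (fun M : Matrix.SpecialLinearGroup (Fin n) ℤ => (M : Matrix (Fin n) (Fin n) ℤ) i j) h1
  simp [tv_coe h, h] at this
  exact ht this
end TV

lemma group_data (n : ℕ) (Γ : Subgroup (Matrix.SpecialLinearGroup (Fin n) ℤ)) (hΓ : Γ.FiniteIndex)
    (ι : Γ →* Cremona) (hι : Function.Injective ι) :
    ∃ (E : Fin n → Fin n → ℤ → Cremona) (m : ℤ), m ≠ 0 ∧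
    (∀ i j, i ≠ j → ∀ s t, E i j (s + t) = E i j s * E i j t) ∧
    (∀ i k j, i ≠ k → k ≠ j → i ≠ j → ∀ s t, E i k s * E k j t = E i j (m * s * t) * E k j t * E i k s) ∧
    (∀ i j k l, i ≠ j → k ≠ l → j ≠ k → i ≠ l → ∀ s t, E i j s * E k l t = E k l t * E i j s) ∧
    (∀ i j, i ≠ j → ∀ t, t ≠ 0 → E i j t ≠ 1) := by
  classical
  let m : ℕ := Γ.index.factorial
  have hm : ∀ i j t, i ≠ j → tv i j (m * t) ∈ Γ := by
    intro i j t h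
    rw [tv_pow i j h]
    exact Γ.pow_mem_of_index_ne_zero_of_dvd hΓ.index_ne_zero _ fun k hk hk' => Nat.dvd_factorial hk hk'
  let E : Fin n → Fin n → ℤ → Cremona := fun i j t => if h : i ≠ j then ι ⟨tv i j (m * t), hm i j t h⟩ else 1
  have hE : ∀ i j t (h : i ≠ j), E i j t = ι ⟨tv i j (m * t), hm i j t h⟩ := fun i j t h => by
    simp only [E, dif_pos h]
  have hm0 : (m : ℤ) ≠ 0 := by exact_mod_cast Nat.factorial_ne_zero _
  refine ⟨E, m, hm0, ?_, ?_, ?_, ?_⟩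
  · intro i j h s t
    simp only [hE _ _ _ h, ← map_mul]
    congr 1
    apply Subtype.ext
    simp only [Subgroup.coe_mul, mul_add, tv_add i j h]
  · intro i k j h1 h2 h3 s t
    simp only [hE _ _ _ h1, hE _ _ _ h2, hE _ _ _ h3, ← map_mul]
    congr 1
    apply Subtype.ext
    simp only [Subgroup.coe_mul]
    rw [tv_commutator i k j h1 h2 h3]
    congr 3
    ring
  · intro i j k l h1 h2 h3 h4 s t
    simp only [hE _ _ _ h1, hE _ _ _ h2, ← map_mul]
    congr 1
    apply Subtype.ext
    simp only [Subgroup.coe_mul]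
    exact tv_comm i j k l h1 h2 h3 h4 _ _
  · intro i j h t ht h1
    rw [hE _ _ _ h, ← map_one ι] at h1
    have := congrArg Subtype.val (hι h1)
    exact tv_ne_one i j h _ (mul_ne_zero hm0 ht) this

section PartD
variable {p : ℕ} [hp : Fact p.Prime] {O : Subring ℂ} (r : O →+* ZMod p) (b : Fin 2 → ZMod p)

/-- affine substitution -/
def affS : MvPolynomial (Fin 2) ℂ →ₐ[ℂ] MvPolynomial (Fin 2) ℂ :=
  aeval fun i => C ((p : ℂ)⁻¹) * (X i - C ((b i).val : ℂ))

/-- embedding of `O[S,T]`, `S = (x - β)/p` -/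
def jS : MvPolynomial (Fin 2) O →+* K2 :=
  ((algebraMap (MvPolynomial (Fin 2) ℂ) K2).comp (affS b).toRingHom).comp (MvPolynomial.map O.subtype)

omit hp in
lemma p_ne_zero' [hp : Fact p.Prime] : (p : ℂ) ≠ 0 := by exact_mod_cast hp.out.ne_zero

lemma affS_inj : Function.Injective (affS b) := by
  let ψ : MvPolynomial (Fin 2) ℂ →ₐ[ℂ] MvPolynomial (Fin 2) ℂ :=
    aeval fun i => C (p : ℂ) * X i + C ((b i).val : ℂ)
  have h : ψ.comp (affS b) = AlgHom.id ℂ _ := by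
    apply MvPolynomial.algHom_ext
    intro i
    have h1 : (C ((p : ℂ)⁻¹) * C (p : ℂ) : MvPolynomial (Fin 2) ℂ) = 1 := by
      rw [← C_mul, inv_mul_cancel₀ (p_ne_zero' (p := p)), C_1]
    have hC : ∀ c : ℂ, ψ (C c) = C c := fun c => by simp [ψ]
    have hX : ψ (X i) = C (p : ℂ) * X i + C ((b i).val : ℂ) := by simp only [ψ, aeval_X]
    have hA : affS b (X i) = C ((p : ℂ)⁻¹) * (X i - C ((b i).val : ℂ)) := by simp only [affS, aeval_X]
    rw [AlgHom.comp_apply, hA, map_mul, map_sub, hC, hC, hX, AlgHom.id_apply]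
    linear_combination X i * h1
  have h2 : ∀ x, ψ (affS b x) = x := fun x => congrArg (fun f => f x) h
  exact Function.LeftInverse.injective h2

variable (O) in
lemma jS_inj : Function.Injective (jS (O := O) b) :=
  ((IsFractionRing.injective (MvPolynomial (Fin 2) ℂ) K2).comp (affS_inj b)).comp
    (MvPolynomial.map_injective _ Subtype.val_injective)

lemma jS_C (c : O) : jS b (C c) = algebraMap ℂ K2 c := by
  simp only [jS, RingHom.comp_apply, map_C]
  have : (affS b).toRingHom (C (c : ℂ)) = C (c : ℂ) := by
    change affS b (C (c : ℂ)) = _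
    simp [affS]
  erw [this]
  exact (IsScalarTower.algebraMap_apply ℂ (MvPolynomial (Fin 2) ℂ) K2 (c : ℂ)).symm

variable (O) in
lemma jS_X (i : Fin 2) : (p : K2) * jS (O := O) b (X i) = jO O (X i) - ((b i).val : K2) := by
  simp only [jS, jO, RingHom.comp_apply, map_X]
  have : (affS b).toRingHom (X i) = C ((p : ℂ)⁻¹) * (X i - C ((b i).val : ℂ)) := by
    change affS b (X i) = _
    simp only [affS, aeval_X]
  rw [this]
  generalize (b i).val = v
  have h1 : (p : MvPolynomial (Fin 2) ℂ) * (C ((p : ℂ)⁻¹) * (X i - C (v : ℂ))) = X i - C (v : ℂ) := by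
    have h1 : ((p : MvPolynomial (Fin 2) ℂ) * C ((p : ℂ)⁻¹) : MvPolynomial (Fin 2) ℂ) = 1 := by
      have : (p : MvPolynomial (Fin 2) ℂ) = C (p : ℂ) := by simp
      rw [this, ← C_mul, mul_inv_cancel₀ (p_ne_zero' (p := p)), C_1]
    rw [← mul_assoc, h1, one_mul]
  have h2 := congrArg (algebraMap (MvPolynomial (Fin 2) ℂ) K2) h1
  rw [map_mul, map_natCast, map_sub _ (X i)] at h2
  have h3 : (C (v : ℂ) : MvPolynomial (Fin 2) ℂ) = (v : MvPolynomial (Fin 2) ℂ) := map_natCast C v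
  rw [h2, h3, map_natCast]

/-- residue field of the Gauss ring -/
abbrev KR (p : ℕ) [Fact p.Prime] : Type := FractionRing (MvPolynomial (Fin 2) (ZMod p))

/-- reduction -/
def eS : MvPolynomial (Fin 2) O →+* KR p :=
  (algebraMap (MvPolynomial (Fin 2) (ZMod p)) (KR p)).comp (MvPolynomial.map r)

/-- Gauss ring -/
def VV : Subring K2 := Loc (jS b) (eS r)

/-- constants of the residue field -/
def embR : ZMod p →+* KR p := (algebraMap (MvPolynomial (Fin 2) (ZMod p)) (KR p)).comp C

variable {r} (h1 : ∀ z : O, r z = 0 → ∃ w : O, z = p * w)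
  (h2 : ∀ z : O, (∀ k : ℕ, ∃ w : O, z = p ^ k * w) → z = 0)

include h1 in
lemma eS_ker (N : MvPolynomial (Fin 2) O) : eS r N = 0 ↔ (p : MvPolynomial (Fin 2) O) ∣ N := by
  have hpC : (p : MvPolynomial (Fin 2) O) = C (p : O) := by simp
  constructor
  · intro h
    have : MvPolynomial.map r N = 0 := by
      apply IsFractionRing.injective (MvPolynomial (Fin 2) (ZMod p)) (KR p)
      rw [map_zero]; exact h
    rw [hpC, C_dvd_iff_dvd_coeff]
    intro k
    obtain ⟨w, hw⟩ := h1 (N.coeff k) (by rw [← coeff_map, this, coeff_zero])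
    exact ⟨w, hw⟩
  · rintro ⟨w, rfl⟩
    rw [map_mul, map_natCast]
    have : (p : KR p) = 0 := by
      have := map_natCast (embR (p := p)) p
      rw [← this]; simp
    rw [this, zero_mul]

lemma res_p : Res (jS b) (eS r) (p : K2) 0 := by
  have := Res.map (j := jS b) (e := eS r) (p : MvPolynomial (Fin 2) O)
  have h0 : (p : KR p) = 0 := by
    have := map_natCast (embR (p := p)) p
    rw [← this]; simp
  simpa [h0] using this

include h1 in
lemma res_zero_VV {f : K2} (h : Res (jS b) (eS r) f 0) : ∃ v ∈ VV r b, f = p * v := by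
  obtain ⟨N, D, hD, hf, hN⟩ := h
  rw [zero_mul, eS_ker h1] at hN
  obtain ⟨N1, rfl⟩ := hN
  have hD0 : jS b D ≠ 0 := fun h => hD (by rw [jS_inj O b (h.trans (map_zero _).symm), map_zero])
  refine ⟨jS b N1 / jS b D, ⟨eS r N1 / eS r D, N1, D, hD, by field_simp, by field_simp⟩, ?_⟩
  rw [map_mul, map_natCast] at hf
  field_simp
  exact hf

lemma pK_ne : (p : K2) ≠ 0 := by
  have : (algebraMap ℂ K2 (p : ℂ)) ≠ 0 := by
    rw [Ne, map_eq_zero]; exact p_ne_zero'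
  simpa using this

include h1 in
lemma prime_p : Prime ((p : ℕ) : VV r b) := by
  refine ⟨?_, ?_, ?_⟩
  · intro h
    exact pK_ne (p := p) (by exact_mod_cast congrArg (Subtype.val) h)
  · intro h
    obtain ⟨v, hv⟩ := h.exists_right_inv
    obtain ⟨w, hw⟩ := v.2
    have := (res_p (r := r) b).mul hw
    have e : (p : K2) * v = 1 := by exact_mod_cast congrArg Subtype.val hv
    rw [e, zero_mul] at this
    exact one_ne_zero (Res.one.unique (jS_inj O b) this)
  · rintro f g ⟨v, hv⟩
    obtain ⟨w, hw⟩ := v.2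
    obtain ⟨wf, hf⟩ := f.2
    obtain ⟨wg, hg⟩ := g.2
    have e : (f : K2) * g = (p : K2) * v := by exact_mod_cast congrArg Subtype.val hv
    have e1 := (res_p (r := r) b).mul hw
    rw [← e] at e1
    have e2 := (hf.mul hg).unique (jS_inj O b) e1
    rw [zero_mul, mul_eq_zero] at e2
    rcases e2 with rfl | rfl
    · left
      obtain ⟨v, hv, h⟩ := res_zero_VV b h1 hf
      exact ⟨⟨v, hv⟩, Subtype.ext (by push_cast; exact h)⟩
    · right
      obtain ⟨v, hv, h⟩ := res_zero_VV b h1 hg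
      exact ⟨⟨v, hv⟩, Subtype.ext (by push_cast; exact h)⟩

include h1 in
lemma prime_pR : Prime ((p : ℕ) : MvPolynomial (Fin 2) O) := by
  refine ⟨?_, ?_, ?_⟩
  · intro h
    apply pK_ne (p := p)
    have := congrArg (jO O) h
    simpa using this
  · intro h
    have := (eS_ker h1 1).mpr h.dvd
    simp at this
  · intro f g h
    rw [← eS_ker h1, ← eS_ker h1]
    rw [← eS_ker h1, map_mul, mul_eq_zero] at h
    exact h

include h1 h2 in
lemma sep_VV (f : VV r b) (hf : ∀ k : ℕ, ((p : ℕ) : VV r b) ^ k ∣ f) : f = 0 := by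
  obtain ⟨w, N, D, hD, hfD, hN⟩ := f.2
  have hpk : ∀ k : ℕ, (p : MvPolynomial (Fin 2) O) ^ k ∣ N := by
    intro k
    obtain ⟨v, hv⟩ := hf k
    obtain ⟨w', N', D', hD', hvD, hN'⟩ := v.2
    have e : (f : K2) = (p : K2) ^ k * v := by exact_mod_cast congrArg Subtype.val hv
    have e1 : N * D' = (p : MvPolynomial (Fin 2) O) ^ k * (N' * D) := by
      apply jS_inj O b
      simp only [map_mul, map_pow, map_natCast, ← hfD, ← hvD, e]
      ring
    refine (prime_pR h1).pow_dvd_of_dvd_mul_right k ?_ ⟨_, e1⟩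
    rw [← eS_ker h1]; exact hD'
  have hN0 : N = 0 := by
    ext k
    have := h2 (N.coeff k) (fun i => by
      have hh := hpk i
      have hpC : (p : MvPolynomial (Fin 2) O) ^ i = C ((p : O) ^ i) := by simp
      rw [hpC, C_dvd_iff_dvd_coeff] at hh
      exact hh k)
    rw [this, coeff_zero]
  have hD0 : jS b D ≠ 0 := fun h => hD (by rw [jS_inj O b (h.trans (map_zero _).symm), map_zero])
  rw [hN0, map_zero, mul_eq_zero] at hfD
  exact Subtype.ext (hfD.resolve_right hD0)
end PartD

section PartD2
open Pointwise
variable {p : ℕ} [hp : Fact p.Prime] {O : Subring ℂ} {r : O →+* ZMod p} (b : Fin 2 → ZMod p)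

lemma embR_inj : Function.Injective (embR (p := p)) := (embR (p := p)).injective

lemma KR_p : (p : KR p) = 0 := by
  have := map_natCast (embR (p := p)) p
  rw [← this]; simp

lemma res_LL_VV {f : K2} {w : ZMod p} (h : Res (jO O) (evb r b) f w) : Res (jS b) (eS r) f (embR w) := by
  have h' : Res (jO O) (embR.comp (evb r b)) f (embR w) := by
    obtain ⟨N, D, h1, h2, h3⟩ := h
    refine ⟨N, D, ?_, h2, ?_⟩
    · rw [RingHom.comp_apply, Ne, map_eq_zero]; exact h1
    · rw [RingHom.comp_apply, h3, map_mul]; rfl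
  refine Res.transport (jS_inj O b) (RingHom.id K2) ?_ h'
  intro N
  rw [RingHom.id_apply]
  induction N using MvPolynomial.induction_on with
  | C c =>
    have := Res.map (j := jS b) (e := eS r) (C c)
    rw [jS_C, ← jO_C] at this
    simpa [eS, evb, embR] using this
  | add P Q hP hQ => rw [map_add, map_add]; exact hP.add hQ
  | mul_X P i hP =>
    rw [map_mul, map_mul]
    refine hP.mul ?_
    have h1 := (((res_p (r := r) b).mul (Res.map (j := jS b) (e := eS r) (X i)))).add
      (Res.map (j := jS b) (e := eS r) (((b i).val : ℕ) : MvPolynomial (Fin 2) O))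
    rw [jS_X, zero_mul, zero_add, map_natCast, map_natCast, sub_add_cancel] at h1
    have h2 : (embR.comp (evb r b)) (X i) = (((b i).val : ℕ) : KR p) := by
      have : evb r b (X i) = (((b i).val : ℕ) : ZMod p) := by simp [evb]
      rw [RingHom.comp_apply, this, map_natCast]
    rw [h2]; exact h1

/-- maximal ideal -/
def MM (r : O →+* ZMod p) (b : Fin 2 → ZMod p) (f : K2) : Prop := Res (jO O) (evb r b) f 0

/-- square of maximal ideal -/
def MM2 (r : O →+* ZMod p) (b : Fin 2 → ZMod p) : AddSubgroup K2 :=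
  AddSubgroup.closure {z | ∃ f g, MM r b f ∧ MM r b g ∧ z = f * g}

lemma MM_smul (u : Cremona) (hu : u • LL r b = LL r b) {f : K2} (hf : MM r b f) : MM r b (u f) := by
  have key : ∀ f, u f ∈ LL r b ↔ f ∈ LL r b := by
    intro f
    conv_lhs => rw [← hu]
    exact Subring.smul_mem_pointwise_smul_iff (a := u) (S := LL r b) (x := f)
  unfold MM at *
  rw [res_zero_iff jO_inj] at *
  rw [← map_inv₀]
  have k1 := key f
  have k2 := key f⁻¹
  unfold LL at k1 k2
  rw [k1, k2]
  refine ⟨hf.1, hf.2.imp (fun h => by rw [h, map_zero]) id⟩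

lemma MM2_smul (u : Cremona) (hu : u • LL r b = LL r b) {f : K2} (hf : f ∈ MM2 r b) : u f ∈ MM2 r b := by
  induction hf using AddSubgroup.closure_induction with
  | mem x hx =>
    obtain ⟨f, g, hf, hg, rfl⟩ := hx
    exact AddSubgroup.subset_closure ⟨_, _, MM_smul b u hu hf, MM_smul b u hu hg, map_mul _ _ _⟩
  | zero => rw [map_zero]; exact zero_mem _
  | add x y _ _ hx hy => rw [map_add]; exact add_mem hx hy
  | neg x _ hx => rw [map_neg]; exact neg_mem hx

lemma MM_VV (h1 : ∀ z : O, r z = 0 → ∃ w : O, z = p * w) {f : K2} (hf : MM r b f) :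
    ∃ v ∈ VV r b, f = p * v := by
  have := res_LL_VV b hf
  rw [map_zero] at this
  exact res_zero_VV b h1 this

lemma MM2_VV (h1 : ∀ z : O, r z = 0 → ∃ w : O, z = p * w) {f : K2} (hf : f ∈ MM2 r b) :
    ∃ v ∈ VV r b, f = p ^ 2 * v := by
  induction hf using AddSubgroup.closure_induction with
  | mem x hx =>
    obtain ⟨f, g, hf, hg, rfl⟩ := hx
    obtain ⟨v, hv, rfl⟩ := MM_VV b h1 hf
    obtain ⟨w, hw, rfl⟩ := MM_VV b h1 hg
    exact ⟨v * w, mul_mem hv hw, by ring⟩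
  | zero => exact ⟨0, zero_mem _, by simp⟩
  | add x y _ _ hx hy =>
    obtain ⟨v, hv, rfl⟩ := hx
    obtain ⟨w, hw, rfl⟩ := hy
    exact ⟨v + w, add_mem hv hw, by ring⟩
  | neg x _ hx =>
    obtain ⟨v, hv, rfl⟩ := hx
    exact ⟨-v, neg_mem hv, by ring⟩

variable (O) in
/-- local parameter -/
def sB (i : Fin 2) : K2 := jO O (X i) - ((b i).val : K2)

lemma MM_p : MM r b (p : K2) := by
  have := Res.map (j := jO O) (e := evb r b) (p : MvPolynomial (Fin 2) O)
  simpa [MM] using this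

lemma res_nat (c : ZMod p) : Res (jO O) (evb r b) ((c.val : ℕ) : K2) c := by
  have := Res.map (j := jO O) (e := evb r b) ((c.val : ℕ) : MvPolynomial (Fin 2) O)
  rw [map_natCast, map_natCast] at this
  simpa using this

lemma MM_s (i : Fin 2) : MM r b (sB O b i) := by
  have := (res_X (r := r) b i).sub (res_nat b (b i))
  rw [sub_self] at this
  exact this

lemma poly_decomp (N : MvPolynomial (Fin 2) O) : ∃ (w : O) (q : Fin 2 → MvPolynomial (Fin 2) O),
    N = C w + ∑ i, (X i - (((b i).val : ℕ) : MvPolynomial (Fin 2) O)) * q i := by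
  induction N using MvPolynomial.induction_on with
  | C c => exact ⟨c, 0, by simp⟩
  | add P Q hP hQ =>
    obtain ⟨w, q, h⟩ := hP
    obtain ⟨w', q', h'⟩ := hQ
    refine ⟨w + w', q + q', ?_⟩
    conv_lhs => rw [h, h']
    simp only [Fin.sum_univ_two, Pi.add_apply, C_add]
    ring
  | mul_X P i hP =>
    obtain ⟨w, q, h⟩ := hP
    refine ⟨w * (b i).val, fun k => q k * X i + if k = i then C w else 0, ?_⟩
    conv_lhs => rw [h]
    have e : (C (w * ((b i).val : O)) : MvPolynomial (Fin 2) O) = C w * (((b i).val : ℕ) : MvPolynomial (Fin 2) O) := by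
      rw [C_mul]; congr 1
    rw [e]
    fin_cases i <;> simp [Fin.sum_univ_two] <;> ring

lemma MM_cls (h1 : ∀ z : O, r z = 0 → ∃ w : O, z = p * w) {f : K2} (hf : MM r b f) :
    ∃ c : ZMod p × ZMod p × ZMod p,
      f - ((p : K2) * (c.1.val : K2) + sB O b 0 * (c.2.1.val : K2) + sB O b 1 * (c.2.2.val : K2)) ∈ MM2 r b := by
  obtain ⟨N, D, hD, hfD, hN⟩ := hf
  obtain ⟨w, q, rfl⟩ := poly_decomp b N
  have hD0 : jO O D ≠ 0 := fun h => hD (by rw [jO_inj (h.trans (map_zero _).symm), map_zero])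
  have hw : r w = 0 := by
    rw [zero_mul] at hN
    have hv : ∀ i, evb r b (X i - (((b i).val : ℕ) : MvPolynomial (Fin 2) O)) = 0 := by
      intro i
      rw [map_sub, map_natCast]
      simp [evb]
    simp only [map_add, Fin.sum_univ_two, map_mul, hv, zero_mul, add_zero] at hN
    simpa [evb] using hN
  obtain ⟨w, rfl⟩ := h1 w hw
  have hq : ∀ q : MvPolynomial (Fin 2) O, Res (jO O) (evb r b) (jO O q / jO O D) (evb r b q / evb r b D) :=
    fun q => ⟨q, D, hD, by field_simp, by field_simp⟩
  have hm : ∀ q : MvPolynomial (Fin 2) O, ∃ c : ZMod p, MM r b (jO O q / jO O D - (c.val : K2)) := by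
    intro q
    have := (hq q).sub (res_nat b (evb r b q / evb r b D))
    rw [sub_self] at this
    exact ⟨_, this⟩
  obtain ⟨c0, h0⟩ := hm (C w)
  obtain ⟨c1, hc1⟩ := hm (q 0)
  obtain ⟨c2, hc2⟩ := hm (q 1)
  refine ⟨(c0, c1, c2), ?_⟩
  have e : f - ((p : K2) * (c0.val : K2) + sB O b 0 * (c1.val : K2) + sB O b 1 * (c2.val : K2)) =
      p * (jO O (C w) / jO O D - (c0.val : K2)) + sB O b 0 * (jO O (q 0) / jO O D - (c1.val : K2))
        + sB O b 1 * (jO O (q 1) / jO O D - (c2.val : K2)) := by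
    have e1 : f = p * (jO O (C w) / jO O D) + sB O b 0 * (jO O (q 0) / jO O D) + sB O b 1 * (jO O (q 1) / jO O D) := by
      have e2 : (C ((p : O) * w) : MvPolynomial (Fin 2) O) = (p : MvPolynomial (Fin 2) O) * C w := by
        rw [C_mul]; congr 1
      rw [e2, Fin.sum_univ_two] at hfD
      simp only [map_add, map_mul, map_sub _ (X _), map_natCast] at hfD
      unfold sB
      field_simp
      rw [hfD]; ring
    linear_combination e1
  rw [e]
  refine add_mem (add_mem ?_ ?_) ?_
  · exact AddSubgroup.subset_closure ⟨_, _, MM_p b, h0, rfl⟩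
  · exact AddSubgroup.subset_closure ⟨_, _, MM_s b 0, hc1, rfl⟩
  · exact AddSubgroup.subset_closure ⟨_, _, MM_s b 1, hc2, rfl⟩

lemma MM2_pow (h1 : ∀ z : O, r z = 0 → ∃ w : O, z = p * w) (u : Cremona) (hu : u • LL r b = LL r b) :
    ∃ n : ℕ, 0 < n ∧ ∀ i, (u ^ n) (sB O b i) - sB O b i ∈ MM2 r b := by
  have hst : ∀ n : ℕ, (u ^ n) • LL r b = LL r b := fun n =>
    (MulAction.stabilizer Cremona (LL r b)).pow_mem (show u ∈ MulAction.stabilizer Cremona (LL r b) from hu) n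
  have hc := fun (n : ℕ) (i : Fin 2) => MM_cls b h1 (MM_smul b (u ^ n) (hst n) (MM_s (r := r) b i))
  choose c hc using hc
  obtain ⟨m, n, hmn, he⟩ : ∃ m n, m < n ∧ c m = c n := by
    obtain ⟨m, n, hne, he⟩ := Finite.exists_ne_map_eq_of_infinite c
    rcases lt_or_gt_of_ne hne with h | h
    · exact ⟨m, n, h, he⟩
    · exact ⟨n, m, h, he.symm⟩
  refine ⟨n - m, by omega, fun i => ?_⟩
  have h3 := sub_mem (hc n i) (hc m i)
  rw [he, sub_sub_sub_cancel_right] at h3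
  have h4 := MM2_smul b ((u ^ m)⁻¹)
    ((MulAction.stabilizer Cremona (LL r b)).inv_mem (show u ^ m ∈ MulAction.stabilizer Cremona (LL r b) from hst m)) h3
  rw [map_sub] at h4
  have e1 : (u ^ m)⁻¹ ((u ^ n) (sB O b i)) = (u ^ (n - m)) (sB O b i) := by
    rw [← AlgEquiv.mul_apply]; congr 1
    rw [inv_mul_eq_iff_eq_mul, ← pow_add]; congr 1; omega
  have e2 : (u ^ m)⁻¹ ((u ^ m) (sB O b i)) = sB O b i := by
    rw [← AlgEquiv.mul_apply, inv_mul_cancel]; rfl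
  rwa [e1, e2] at h4

lemma cong_of_gen (h1 : ∀ z : O, r z = 0 → ∃ w : O, z = p * w) (u : Cremona)
    (hu : ∀ i, u (sB O b i) - sB O b i ∈ MM2 r b) : ∀ f ∈ VV r b, ∃ v ∈ VV r b, u f - f = p * v := by
  have hX : ∀ i, Res (jS b) (eS r) (u (jS (O := O) b (X i))) (eS r (X i)) := by
    intro i
    obtain ⟨v, ⟨w, hv⟩, h⟩ := MM2_VV b h1 (hu i)
    have e : u (jS (O := O) b (X i)) = jS (O := O) b (X i) + p * v := by
      apply mul_left_cancel₀ (pK_ne (p := p))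
      have e1 : (p : K2) * u (jS (O := O) b (X i)) = u (p * jS (O := O) b (X i)) := by
        rw [map_mul, map_natCast]
      have hs : (p : K2) * jS (O := O) b (X i) = sB O b i := jS_X O b i
      rw [e1, hs, mul_add, hs]
      linear_combination h
    rw [e]
    have := (Res.map (j := jS b) (e := eS r) (X i)).add ((res_p (r := r) b).mul hv)
    rwa [zero_mul, add_zero] at this
  have hN : ∀ N, Res (jS b) (eS r) ((u : K2 →+* K2) (jS b N)) (eS r N) := by
    intro N
    induction N using MvPolynomial.induction_on with
    | C c =>
      have e : (u : K2 →+* K2) (jS b (C c)) = jS b (C c) := by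
        rw [jS_C]; exact u.commutes _
      rw [e]
      exact Res.map (C c)
    | add P Q hP hQ => rw [map_add, map_add, map_add]; exact hP.add hQ
    | mul_X P i hP =>
      rw [map_mul, map_mul, map_mul]
      exact hP.mul (hX i)
  rintro f ⟨w, hf⟩
  have h2 : Res (jS b) (eS r) (u f) w := Res.transport (jS_inj O b) (u : K2 →+* K2) hN hf
  have h3 := h2.sub hf
  rw [sub_self] at h3
  exact res_zero_VV b h1 h3

lemma cong_exists (h1 : ∀ z : O, r z = 0 → ∃ w : O, z = p * w) (u : Cremona) (hu : u • LL r b = LL r b) :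
    ∃ n : ℕ, 0 < n ∧ (∀ f ∈ VV r b, ∃ v ∈ VV r b, (u ^ n) f - f = p * v) ∧
      (∀ f ∈ VV r b, (u ^ n)⁻¹ f ∈ VV r b) := by
  obtain ⟨n, hn, h⟩ := MM2_pow b h1 u hu
  have h' : ∀ i, (u ^ n)⁻¹ (sB O b i) - sB O b i ∈ MM2 r b := by
    intro i
    have hs : (u ^ n)⁻¹ • LL r b = LL r b :=
      (MulAction.stabilizer Cremona (LL r b)).inv_mem
        ((MulAction.stabilizer Cremona (LL r b)).pow_mem (show u ∈ MulAction.stabilizer Cremona (LL r b) from hu) n)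
    have h2 := neg_mem (MM2_smul b _ hs (h i))
    rw [map_sub] at h2
    have e2 : (u ^ n)⁻¹ ((u ^ n) (sB O b i)) = sB O b i := by
      rw [← AlgEquiv.mul_apply, inv_mul_cancel]; rfl
    rwa [e2, neg_sub] at h2
  refine ⟨n, hn, cong_of_gen b h1 _ h, fun f hf => ?_⟩
  obtain ⟨v, hv, e⟩ := cong_of_gen b h1 _ h' f hf
  have : (u ^ n)⁻¹ f = f + p * v := by linear_combination e
  rw [this]
  exact add_mem hf (mul_mem (natCast_mem _ _) hv)

end PartD2

section LieLemma
variable {R : Type} [CommRing R] [IsDomain R]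

lemma lie_lemma (A1 B1 A2 B2 Z : Derivation ℤ R R) (s t : R)
    (hker : ∀ D ∈ Submodule.span R {A1, B1, A2, B2, Z}, D s = 0 → D t = 0 → D = 0)
    (h1 : ∀ x, A1 (B1 x) - B1 (A1 x) = Z x) (h2 : ∀ x, A2 (B2 x) - B2 (A2 x) = Z x)
    (hA1Z : ∀ x, A1 (Z x) = Z (A1 x)) (hB1Z : ∀ x, B1 (Z x) = Z (B1 x))
    (hA2Z : ∀ x, A2 (Z x) = Z (A2 x)) (hB2Z : ∀ x, B2 (Z x) = Z (B2 x))
    (hAA : ∀ x, A1 (A2 x) = A2 (A1 x)) (hAB : ∀ x, A1 (B2 x) = B2 (A1 x))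
    (hBA : ∀ x, B1 (A2 x) = A2 (B1 x)) (hBB : ∀ x, B1 (B2 x) = B2 (B1 x)) : Z = 0 := by
  have mA1 : A1 ∈ Submodule.span R {A1, B1, A2, B2, Z} := Submodule.subset_span (by simp)
  have mB1 : B1 ∈ Submodule.span R {A1, B1, A2, B2, Z} := Submodule.subset_span (by simp)
  have mA2 : A2 ∈ Submodule.span R {A1, B1, A2, B2, Z} := Submodule.subset_span (by simp)
  have mB2 : B2 ∈ Submodule.span R {A1, B1, A2, B2, Z} := Submodule.subset_span (by simp)
  have mZ : Z ∈ Submodule.span R {A1, B1, A2, B2, Z} := Submodule.subset_span (by simp)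
  generalize Submodule.span R {A1, B1, A2, B2, Z} = V at *
  -- Case 2
  have case2 : ∀ X ∈ V, (∀ x, X (Z x) = Z (X x)) → (∀ x, X (A2 x) = A2 (X x)) → (∀ x, X (B2 x) = B2 (X x)) →
      X s * Z t - X t * Z s ≠ 0 → Z = 0 := by
    intro X mX hXZ hXA hXB hδ
    set δ := X s * Z t - X t * Z s with hδd
    -- Cramer
    have cramer : ∀ Y ∈ V, ∀ x, δ * Y x = (Y s * Z t - Y t * Z s) * X x + (X s * Y t - X t * Y s) * Z x := by
      intro Y mY x
      have := hker (δ • Y - (Y s * Z t - Y t * Z s) • X - (X s * Y t - X t * Y s) • Z)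
        (V.sub_mem (V.sub_mem (V.smul_mem _ mY) (V.smul_mem _ mX)) (V.smul_mem _ mZ))
        (by simp [hδd]; ring) (by simp [hδd]; ring)
      have h := DFunLike.congr_fun this x
      simp at h
      linear_combination h
    -- for Y commuting with X and Z, the coefficients are proportional to δ under X, Z
    have key : ∀ Y ∈ V, (∀ x, X (Y x) = Y (X x)) → (∀ x, Z (Y x) = Y (Z x)) → ∀ W : Derivation ℤ R R, (W = X ∨ W = Z) →
        (W δ * (Y s * Z t - Y t * Z s) = δ * W (Y s * Z t - Y t * Z s)) ∧
        (W δ * (X s * Y t - X t * Y s) = δ * W (X s * Y t - X t * Y s)) := by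
      intro Y mY hXY hZY W hW
      set f := (Y s * Z t - Y t * Z s) with hf
      set g := (X s * Y t - X t * Y s) with hg
      have hWY : ∀ x, W (Y x) = Y (W x) := by rcases hW with rfl | rfl <;> assumption
      have hWX : ∀ x, W (X x) = X (W x) := by
        rcases hW with rfl | rfl
        · intro x; rfl
        · intro x; exact (hXZ x).symm
      have hWZ : ∀ x, W (Z x) = Z (W x) := by
        rcases hW with rfl | rfl
        · exact hXZ
        · intro x; rfl
      have hx : ∀ x, W δ * Y x = W f * X x + W g * Z x := by
        intro x
        have e1 := congrArg W (cramer Y mY x)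
        simp only [Derivation.leibniz, map_add, smul_eq_mul, ← hf, ← hg] at e1
        rw [hWY, hWX, hWZ] at e1
        have e2 := cramer Y mY (W x)
        rw [← hf, ← hg] at e2
        linear_combination e1 - e2
      have hs := hx s
      have ht := hx t
      constructor
      · rw [hf, hδd]
        rw [hf] at hs ht
        linear_combination Z t * hs - Z s * ht
      · rw [hg, hδd]
        rw [hg] at hs ht
        linear_combination X s * ht - X t * hs
    have kA := key A2 mA2 hXA (fun x => (hA2Z x).symm)
    have kB := key B2 mB2 hXB (fun x => (hB2Z x).symm)
    set f := (A2 s * Z t - A2 t * Z s) with hf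
    set g := (X s * A2 t - X t * A2 s) with hg
    set f' := (B2 s * Z t - B2 t * Z s) with hf'
    set g' := (X s * B2 t - X t * B2 s) with hg'
    have cA : ∀ x, δ * A2 x = f * X x + g * Z x := cramer A2 mA2
    have cB : ∀ x, δ * B2 x = f' * X x + g' * Z x := cramer B2 mB2
    have m1 : A2 δ * f' = δ * A2 f' := by
      apply mul_left_cancel₀ hδ
      have a := (kB X (Or.inl rfl)).1
      have c := (kB Z (Or.inr rfl)).1
      linear_combination f' * cA δ - δ * cA f' + f * a + g * c
    have m2 : A2 δ * g' = δ * A2 g' := by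
      apply mul_left_cancel₀ hδ
      have a := (kB X (Or.inl rfl)).2
      have c := (kB Z (Or.inr rfl)).2
      linear_combination g' * cA δ - δ * cA g' + f * a + g * c
    have comm : ∀ x, A2 (B2 x) = B2 (A2 x) := by
      intro x
      apply mul_left_cancel₀ hδ
      apply mul_left_cancel₀ hδ
      have e := congrArg A2 (cB x)
      simp only [Derivation.leibniz, map_add, smul_eq_mul] at e
      have e2 := cB (A2 x)
      rw [hXA x, ← hA2Z x] at e2
      linear_combination δ * e - δ * e2 - A2 δ * cB x - X x * m1 - Z x * m2
    apply hker Z mZ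
    · rw [← h2, comm, sub_self]
    · rw [← h2, comm, sub_self]
  by_cases hA : A1 s * Z t - A1 t * Z s = 0
  swap
  · exact case2 A1 mA1 hA1Z hAA hAB hA
  by_cases hB : B1 s * Z t - B1 t * Z s = 0
  swap
  · exact case2 B1 mB1 hB1Z hBA hBB hB
  -- Case 1
  have case1 : ∀ s t : R, (∀ D ∈ V, D s = 0 → D t = 0 → D = 0) → A1 s * Z t - A1 t * Z s = 0 →
      B1 s * Z t - B1 t * Z s = 0 → Z s = 0 := by
    intro s t hker hA hB
    by_contra hz
    set z := Z s with hzd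
    have hA' : ∀ x, z * A1 x = A1 s * Z x := by
      intro x
      have := hker (z • A1 - A1 s • Z) (V.sub_mem (V.smul_mem _ mA1) (V.smul_mem _ mZ))
        (by simp [hzd]; ring) (by simp; linear_combination -hA)
      have h := DFunLike.congr_fun this x
      simp at h
      linear_combination h
    have hB' : ∀ x, z * B1 x = B1 s * Z x := by
      intro x
      have := hker (z • B1 - B1 s • Z) (V.sub_mem (V.smul_mem _ mB1) (V.smul_mem _ mZ))
        (by simp [hzd]; ring) (by simp; linear_combination -hB)
      have h := DFunLike.congr_fun this x
      simp at h
      linear_combination h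
    have a := hA' z
    have c := hB' z
    have e1 := hA' (B1 s)
    have e2 := hB' (A1 s)
    have e3 := h1 s
    have z1 : A1 z = Z (A1 s) := hA1Z s
    have z2 : B1 z = Z (B1 s) := hB1Z s
    rw [z1] at a
    rw [z2] at c
    have : z * z * z = 0 := by
      linear_combination (-z * z) * e3 + z * e1 - z * e2 + A1 s * c - B1 s * a
    simp [hz] at this
  exact hker Z mZ (case1 s t hker hA hB)
    (case1 t s (fun D hD h1 h2 => hker D hD h2 h1) (by linear_combination -hA) (by linear_combination -hB))

end LieLemma

section PartE
set_option linter.unusedSectionVars false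
variable {W : Type} [CommRing W] [IsDomain W] {p : ℕ}

/-- congruence condition -/
def CongW (p : ℕ) (J : ℕ) (σ : RingAut W) : Prop := ∀ f, (p : W) ^ J ∣ σ f - f

lemma cong_pow_lin {J : ℕ} {σ : RingAut W} (h : CongW p J σ) (k : ℕ) (f : W) :
    (p : W) ^ (2 * J) ∣ (σ ^ k) f - f - k * (σ f - f) := by
  induction k with
  | zero => simp
  | succ k ih =>
    obtain ⟨w, hw⟩ := ih
    obtain ⟨v, hv⟩ := h f
    obtain ⟨u, hu⟩ := h v
    have e : (σ ^ (k + 1)) f = σ ((σ ^ k) f) := by rw [pow_succ', RingAut.mul_apply]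
    have e2 : (σ ^ k) f = f + k * (p ^ J * v) + p ^ (2 * J) * w := by rw [← hv]; linear_combination hw
    have e3 : σ f = f + p ^ J * v := by linear_combination hv
    have e4 : σ v = v + p ^ J * u := by linear_combination hu
    rw [e, e2]
    simp only [map_add, map_mul, map_pow, map_natCast, e3, e4]
    refine ⟨k * u + σ w, ?_⟩
    push_cast
    ring

lemma cong_pow_p {J : ℕ} (hJ : 1 ≤ J) {σ : RingAut W} (h : CongW p J σ) : CongW p (J + 1) (σ ^ p) := by
  intro f
  obtain ⟨w, hw⟩ := (pow_dvd_pow (p : W) (show J + 1 ≤ 2 * J by omega)).trans (cong_pow_lin h p f)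
  obtain ⟨v, hv⟩ := h f
  refine ⟨w + v, ?_⟩
  rw [hv] at hw
  linear_combination hw

lemma cong_pow {J : ℕ} (hJ : 1 ≤ J) {σ : RingAut W} (h : CongW p J σ) (i : ℕ) :
    CongW p (J + i) (σ ^ (p ^ i)) := by
  induction i with
  | zero => simpa using h
  | succ i ih =>
    have := cong_pow_p (by omega) ih
    rwa [← pow_mul, ← pow_succ] at this

lemma CongW.mono {J J' : ℕ} (hJ : J' ≤ J) {σ : RingAut W} (h : CongW p J σ) : CongW p J' σ :=
  fun f => (pow_dvd_pow _ hJ).trans (h f)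

lemma CongW.pow {J : ℕ} {σ : RingAut W} (h : CongW p J σ) (k : ℕ) : CongW p J (σ ^ k) := by
  intro f
  obtain ⟨w, hw⟩ := (pow_dvd_pow (p : W) (show J ≤ 2 * J by omega)).trans (cong_pow_lin h k f)
  obtain ⟨v, hv⟩ := h f
  refine ⟨w + k * v, ?_⟩
  rw [hv] at hw
  linear_combination hw

lemma exists_quot (d : W) (hd : d ≠ 0) (τ : RingAut W) (h : ∀ f, d ∣ τ f - f) :
    ∃ A : W →+ W, ∀ f, d * A f = τ f - f := by
  choose A hA using h
  refine ⟨AddMonoidHom.mk' A ?_, fun f => (hA f).symm⟩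
  intro f g
  apply mul_left_cancel₀ hd
  rw [mul_add, ← hA, ← hA, ← hA, map_add]
  ring

lemma quot_leibniz {d : W} (hd : d ≠ 0) {τ : RingAut W} {A : W →+ W} (h : ∀ f, d * A f = τ f - f) (f g : W) :
    A (f * g) = f * A g + g * A f + d * (A f * A g) := by
  apply mul_left_cancel₀ hd
  have e : ∀ f, τ f = f + d * A f := fun f => by linear_combination -h f
  rw [h, map_mul, e f, e g]
  ring

lemma add_nat (A : W →+ W) (d : ℕ) (x : W) : A (d * x) = d * A x := by
  rw [← nsmul_eq_mul, map_nsmul, nsmul_eq_mul]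

lemma add_pow_nat (A : W →+ W) (d k : ℕ) (x : W) : A ((d : W) ^ k * x) = (d : W) ^ k * A x := by
  have := add_nat A (d ^ k) x
  exact_mod_cast this

lemma quot_comm (d d' : ℕ) (hd : (d : W) ≠ 0) (hd' : (d' : W) ≠ 0) {τ τ' : RingAut W} (hc : Commute τ τ') {A A' : W →+ W}
    (h : ∀ f, d * A f = τ f - f) (h' : ∀ f, d' * A' f = τ' f - f) (f : W) : A (A' f) = A' (A f) := by
  apply mul_left_cancel₀ hd'
  apply mul_left_cancel₀ hd
  rw [← add_nat A, h]
  have e : (d : W) * (d' * A' (A f)) = d' * (A' (d * A f)) := by rw [add_nat]; ring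
  rw [e, h', h', h]
  have : τ (τ' f) = τ' (τ f) := by rw [← RingAut.mul_apply, hc.eq, RingAut.mul_apply]
  simp only [map_sub, this]
  ring

lemma comm_pow_aux {G : Type*} [Group G] {a b c : G} (h : a * b = c * b * a) (hca : Commute c a) (hcb : Commute c b) (N M : ℕ) :
    a ^ N * b ^ M = c ^ (N * M) * b ^ M * a ^ N := by
  have h1 : SemiconjBy a (b ^ M) (c ^ M * b ^ M) := by
    have : SemiconjBy a b (c * b) := h
    have := this.pow_right M
    rwa [hcb.mul_pow] at this
  induction N with
  | zero => simp
  | succ N ih =>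
    have hh : Commute a (c ^ (N * M)) := (hca.pow_left _).symm
    calc a ^ (N + 1) * b ^ M = a * (a ^ N * b ^ M) := by rw [pow_succ', mul_assoc]
      _ = (a * c ^ (N * M)) * b ^ M * a ^ N := by rw [ih]; simp only [mul_assoc]
      _ = c ^ (N * M) * (a * b ^ M) * a ^ N := by rw [hh.eq]; simp only [mul_assoc]
      _ = c ^ (N * M) * (c ^ M * b ^ M * a) * a ^ N := by rw [h1.eq]
      _ = c ^ ((N + 1) * M) * b ^ M * a ^ (N + 1) := by
        rw [add_mul, one_mul, pow_add, pow_succ' a]; simp only [mul_assoc]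

lemma quot_bracket (N : ℕ) (hN : (N : W) ≠ 0) {a b c : RingAut W} (h : a * b = c * b * a) (hca : Commute c a) (hcb : Commute c b)
    {A B Z : W →+ W} (hA : ∀ f, N * A f = (a ^ N) f - f) (hB : ∀ f, N * B f = (b ^ N) f - f)
    (hZ : ∀ f, (N : W) * N * Z f = (c ^ (N * N)) f - f) (f : W) : (N : W) ∣ A (B f) - B (A f) - Z f := by
  have e1 : A (B f) - B (A f) = Z ((b ^ N) ((a ^ N) f)) := by
    apply mul_left_cancel₀ (mul_ne_zero hN hN)
    rw [hZ]
    have e2 : (c ^ (N * N)) ((b ^ N) ((a ^ N) f)) = (a ^ N) ((b ^ N) f) := by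
      have := comm_pow_aux h hca hcb N N
      simp only [← RingAut.mul_apply, this, mul_assoc]
    have e3 : (N : W) * N * (A (B f) - B (A f)) = N * A (N * B f) - N * B (N * A f) := by
      rw [add_nat, add_nat]; ring
    rw [e2, e3, hA, hB, hA, hB]
    simp only [map_sub]
    ring
  have e4 : (b ^ N) ((a ^ N) f) = f + N * (A f + B (f + N * A f)) := by
    have : (a ^ N) f = f + N * A f := by linear_combination -hA f
    rw [this]
    linear_combination -hB (f + N * A f)
  rw [e1, e4, map_add, add_nat]
  exact ⟨_, add_sub_cancel_left _ _⟩

/-- the ultrafilter -/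
abbrev UU : Ultrafilter ℕ := Filter.hyperfilter ℕ

lemma UU_ge (k : ℕ) : ∀ᶠ m in (UU : Filter ℕ), k ≤ m :=
  Nat.hyperfilter_le_atTop (Filter.eventually_ge_atTop k)

variable (W p) in
/-- the ideal of infinitely divisible sequences -/
def II : Ideal (ℕ → W) where
  carrier := {f | ∀ k : ℕ, ∀ᶠ m in (UU : Filter ℕ), (p : W) ^ k ∣ f m}
  add_mem' := by
    intro f g hf hg k
    filter_upwards [hf k, hg k] with m h1 h2 using dvd_add h1 h2
  zero_mem' := by
    intro k; simp
  smul_mem' := by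
    intro c f hf k
    filter_upwards [hf k] with m h1 using dvd_mul_of_dvd_right h1 _

lemma mem_II {f : ℕ → W} : f ∈ II W p ↔ ∀ k : ℕ, ∀ᶠ m in (UU : Filter ℕ), (p : W) ^ k ∣ f m := Iff.rfl

lemma prime_split {P : W} (hP : Prime P) (k k' : ℕ) : ∀ f g : W, P ^ (k + k') ∣ f * g → P ^ k ∣ f ∨ P ^ k' ∣ g := by
  induction k with
  | zero => intro f g _; left; simp
  | succ k ih =>
    intro f g h
    by_cases hf : P ∣ f
    · obtain ⟨f, rfl⟩ := hf
      have : P ^ (k + k') ∣ f * g := by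
        apply (mul_dvd_mul_iff_left hP.ne_zero).mp
        rw [← pow_succ', ← mul_assoc]
        convert h using 2; ring
      rcases ih f g this with h | h
      · left; rw [pow_succ']; exact mul_dvd_mul_left _ h
      · right; exact h
    · right
      exact (pow_dvd_pow P (by omega)).trans (hP.pow_dvd_of_dvd_mul_left _ hf h)

lemma II_prime (hP : Prime (p : W)) : (II W p).IsPrime := by
  refine ⟨?_, ?_⟩
  · rw [Ne, Ideal.eq_top_iff_one, mem_II]
    intro h
    obtain ⟨m, hm⟩ := (h 1).exists
    rw [pow_one] at hm
    exact hP.not_isUnit (isUnit_of_dvd_one hm)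
  · intro f g hfg
    by_contra hcon
    push Not at hcon
    obtain ⟨hf, hg⟩ := hcon
    rw [mem_II] at hf hg hfg
    push Not at hf hg
    obtain ⟨k, hk⟩ := hf
    obtain ⟨k', hk'⟩ := hg
    obtain ⟨m, h1, h2, h3⟩ := (hk.and (hk'.and (hfg (k + k')))).exists
    rcases prime_split hP k k' _ _ h3 with h | h
    · exact h1 h
    · exact h2 h

variable (W p) in
/-- the ultraproduct ring -/
def RR : Type := (ℕ → W) ⧸ II W p

instance : CommRing (RR W p) := inferInstanceAs (CommRing ((ℕ → W) ⧸ II W p))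

variable (p) in
/-- class map -/
def clHom : (ℕ → W) →+* RR W p := Ideal.Quotient.mk (II W p)

variable (p) in
/-- class -/
def cl (f : ℕ → W) : RR W p := clHom p f

lemma cl_eq {f g : ℕ → W} : cl p f = cl p g ↔ ∀ k : ℕ, ∀ᶠ m in (UU : Filter ℕ), (p : W) ^ k ∣ f m - g m := by
  exact (Ideal.Quotient.eq (I := II W p)).trans mem_II

lemma cl_eq_zero {f : ℕ → W} : cl p f = 0 ↔ ∀ k : ℕ, ∀ᶠ m in (UU : Filter ℕ), (p : W) ^ k ∣ f m := by
  exact (Ideal.Quotient.eq_zero_iff_mem (I := II W p)).trans mem_II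

lemma cl_surj (x : RR W p) : ∃ f, cl p f = x := Ideal.Quotient.mk_surjective x

variable (p) in
/-- approximate derivation -/
def AD (Cst : Set W) (d : ℕ → W →+ W) : Prop :=
  ∀ k : ℕ, ∀ᶠ m in (UU : Filter ℕ), (∀ f g, (p : W) ^ k ∣ d m (f * g) - (f * d m g + g * d m f)) ∧
    ∀ c ∈ Cst, (p : W) ^ k ∣ d m c

lemma exists_der {Cst : Set W} {d : ℕ → W →+ W} (hd : AD p Cst d) :
    ∃ D : Derivation ℤ (RR W p) (RR W p), ∀ f, D (cl p f) = cl p (fun m => d m (f m)) := by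
  choose out hout using cl_surj (W := W) (p := p)
  have hw : ∀ f, cl p (fun m => d m (out (cl p f) m)) = cl p (fun m => d m (f m)) := by
    intro f
    have := hout (cl p f)
    rw [cl_eq] at this ⊢
    intro k
    filter_upwards [this k] with m hm
    obtain ⟨v, hv⟩ := hm
    rw [← map_sub, hv, add_pow_nat]
    exact dvd_mul_right _ _
  refine ⟨Derivation.mk' (AddMonoidHom.toIntLinearMap (AddMonoidHom.mk' (fun x => cl p (fun m => d m (out x m))) ?_)) ?_, hw⟩
  · intro x y
    obtain ⟨f, rfl⟩ := cl_surj x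
    obtain ⟨g, rfl⟩ := cl_surj y
    have e : cl p f + cl p g = cl p (f + g) := (map_add (clHom p) _ _).symm
    rw [e, hw, hw, hw]
    have e : cl p (fun m => d m (f m)) + cl p (fun m => d m (g m)) = cl p (fun m => d m (f m) + d m (g m)) := (map_add (clHom p) _ _).symm
    rw [e]
    congr 1
    funext m
    exact map_add _ _ _
  · intro x y
    obtain ⟨f, rfl⟩ := cl_surj x
    obtain ⟨g, rfl⟩ := cl_surj y
    have e : cl p f * cl p g = cl p (f * g) := (map_mul (clHom p) _ _).symm
    change cl p (fun m => d m (out _ m)) = _ * cl p (fun m => d m (out _ m)) + _ * cl p (fun m => d m (out _ m))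
    rw [e, hw, hw, hw]
    have e : cl p f * cl p (fun m => d m (g m)) + cl p g * cl p (fun m => d m (f m)) =
      cl p (fun m => f m * d m (g m) + g m * d m (f m)) := by
      unfold cl
      rw [← map_mul, ← map_mul, ← map_add]; rfl
    rw [e, cl_eq]
    intro k
    filter_upwards [hd k] with m hm using hm.1 _ _

variable (p) in
/-- representable derivations -/
def RepD (Cst : Set W) : Submodule (RR W p) (Derivation ℤ (RR W p) (RR W p)) where
  carrier := {D | ∃ d, AD p Cst d ∧ ∀ f, D (cl p f) = cl p (fun m => d m (f m))}
  add_mem' := by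
    rintro D D' ⟨d, hd, h⟩ ⟨d', hd', h'⟩
    refine ⟨fun m => d m + d' m, ?_, ?_⟩
    · intro k
      filter_upwards [hd k, hd' k] with m h1 h2
      refine ⟨fun f g => ?_, fun c hc => dvd_add (h1.2 c hc) (h2.2 c hc)⟩
      convert dvd_add (h1.1 f g) (h2.1 f g) using 1
      simp only [AddMonoidHom.add_apply]; ring
    · intro f
      rw [Derivation.add_apply, h, h']
      exact (map_add (clHom p) _ _).symm
  zero_mem' := ⟨fun _ => 0, fun k => by simp, fun f => by
    rw [Derivation.zero_apply]; exact (map_zero (clHom p)).symm⟩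
  smul_mem' := by
    rintro x D ⟨d, hd, h⟩
    obtain ⟨w, rfl⟩ := cl_surj x
    refine ⟨fun m => (AddMonoidHom.mulLeft (w m)).comp (d m), ?_, ?_⟩
    · intro k
      filter_upwards [hd k] with m h1
      refine ⟨fun f g => ?_, fun c hc => dvd_mul_of_dvd_right (h1.2 c hc) _⟩
      convert dvd_mul_of_dvd_right (h1.1 f g) (w m) using 1
      simp only [AddMonoidHom.comp_apply, AddMonoidHom.coe_mulLeft]; ring
    · intro f
      rw [Derivation.smul_apply, h]
      exact (map_mul (clHom p) _ _).symm

/-- rigidity hypothesis -/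
def Rigid (p : ℕ) (Cst : Set W) (s t : W) : Prop :=
  ∀ (D : W →+ W) (k : ℕ), (∀ f g, (p : W) ^ k ∣ D (f * g) - (f * D g + g * D f)) →
    (∀ c ∈ Cst, (p : W) ^ k ∣ D c) → (p : W) ^ k ∣ D s → (p : W) ^ k ∣ D t → ∀ f, (p : W) ^ k ∣ D f

lemma Rep_ker {Cst : Set W} {s t : W} (hR : Rigid p Cst s t) {D : Derivation ℤ (RR W p) (RR W p)}
    (hD : D ∈ RepD p Cst) (hs : D (cl p fun _ => s) = 0) (ht : D (cl p fun _ => t) = 0) : D = 0 := by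
  obtain ⟨d, hd, h⟩ := hD
  ext x
  obtain ⟨f, rfl⟩ := cl_surj x
  rw [h, Derivation.zero_apply, cl_eq_zero]
  rw [h, cl_eq_zero] at hs ht
  intro k
  filter_upwards [hs k, ht k, hd k] with m h1 h2 h3
  exact hR (d m) k h3.1 h3.2 h1 h2 _

lemma quot_AD (hP : Prime (p : W)) {Cst : Set W} (e : ℕ → ℕ) (he : ∀ m, m ≤ e m) {τ : ℕ → RingAut W}
    (hτ : ∀ m, ∀ c ∈ Cst, τ m c = c) {A : ℕ → W →+ W} (h : ∀ m f, (p : W) ^ e m * A m f = τ m f - f) : AD p Cst A := by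
  intro k
  filter_upwards [UU_ge k] with m hm
  have h0 : (p : W) ^ e m ≠ 0 := pow_ne_zero _ hP.ne_zero
  constructor
  · intro f g
    rw [quot_leibniz h0 (h m)]
    rw [add_sub_cancel_left]
    exact ((pow_dvd_pow _ (hm.trans (he m))).trans (dvd_mul_right _ _))
  · intro c hc
    have := h m c
    rw [hτ m c hc, sub_self] at this
    rw [(mul_eq_zero.mp this).resolve_left h0]
    exact dvd_zero _

lemma core_abs (hP : Prime (p : W)) (hsep : ∀ f : W, (∀ k : ℕ, (p : W) ^ k ∣ f) → f = 0)
    (Cst : Set W) (s t : W) (hR : Rigid p Cst s t) (a1 b1 a2 b2 c : RingAut W)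
    (fa1 : ∀ x ∈ Cst, a1 x = x) (fb1 : ∀ x ∈ Cst, b1 x = x) (fa2 : ∀ x ∈ Cst, a2 x = x)
    (fb2 : ∀ x ∈ Cst, b2 x = x) (fc : ∀ x ∈ Cst, c x = x)
    (ca1 : CongW p 1 a1) (cb1 : CongW p 1 b1) (ca2 : CongW p 1 a2) (cb2 : CongW p 1 b2) (cc : CongW p 2 c)
    (h1 : a1 * b1 = c * b1 * a1) (h2 : a2 * b2 = c * b2 * a2)
    (k1 : Commute c a1) (k2 : Commute c b1) (k3 : Commute c a2) (k4 : Commute c b2)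
    (l1 : Commute a1 a2) (l2 : Commute a1 b2) (l3 : Commute b1 a2) (l4 : Commute b1 b2) : c = 1 := by
  by_contra hc1
  have hpm : ∀ m : ℕ, (p : W) ^ m ≠ 0 := fun m => pow_ne_zero _ hP.ne_zero
  -- maximal congruence level
  obtain ⟨j, hj2, hj, f0, hf0⟩ : ∃ j, 2 ≤ j ∧ CongW p j c ∧ ∃ f0, ¬ (p : W) ^ (j + 1) ∣ c f0 - f0 := by
    by_contra hcon
    push Not at hcon
    have : ∀ j, CongW p (2 + j) c := by
      intro j
      induction j with
      | zero => exact cc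
      | succ j ih => exact hcon (2 + j) (by omega) ih
    apply hc1
    ext f
    have := hsep (c f - f) (fun k => (this k).mono (by omega) f)
    rw [RingAut.one_apply]
    linear_combination this
  have hquot : ∀ a : RingAut W, CongW p 1 a → ∀ e : ℕ → ℕ, ∃ A : ℕ → W →+ W, ∀ m f, (p : W) ^ e m * A m f = (a ^ (p ^ e m)) f - f := by
    intro a ha e
    have := fun m => exists_quot ((p : W) ^ e m) (hpm _) (a ^ (p ^ e m)) ((cong_pow le_rfl ha (e m)).mono (by omega))
    choose A hA using this
    exact ⟨A, hA⟩
  have hfix : ∀ a : RingAut W, (∀ x ∈ Cst, a x = x) → ∀ n : ℕ, ∀ x ∈ Cst, (a ^ n) x = x := by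
    intro a ha n x hx
    induction n with
    | zero => rfl
    | succ n ih => rw [pow_succ, RingAut.mul_apply, ha x hx, ih]
  obtain ⟨A1, hA1⟩ := hquot a1 ca1 id
  obtain ⟨B1, hB1⟩ := hquot b1 cb1 id
  obtain ⟨A2, hA2⟩ := hquot a2 ca2 id
  obtain ⟨B2, hB2⟩ := hquot b2 cb2 id
  obtain ⟨Z, hZ⟩ := hquot c (cc.mono (by omega)) (fun m => m + m)
  have adA1 := quot_AD hP id (fun m => le_rfl) (fun m => hfix a1 fa1 _) hA1
  have adB1 := quot_AD hP id (fun m => le_rfl) (fun m => hfix b1 fb1 _) hB1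
  have adA2 := quot_AD hP id (fun m => le_rfl) (fun m => hfix a2 fa2 _) hA2
  have adB2 := quot_AD hP id (fun m => le_rfl) (fun m => hfix b2 fb2 _) hB2
  have adZ := quot_AD hP (fun m => m + m) (fun m => by omega) (fun m => hfix c fc _) hZ
  obtain ⟨DA1, eA1⟩ := exists_der adA1
  obtain ⟨DB1, eB1⟩ := exists_der adB1
  obtain ⟨DA2, eA2⟩ := exists_der adA2
  obtain ⟨DB2, eB2⟩ := exists_der adB2
  obtain ⟨DZ, eZ⟩ := exists_der adZ
  have := II_prime hP
  have : IsDomain (RR W p) := Ideal.Quotient.isDomain (II W p)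
  have hcomm : ∀ (a b : RingAut W) (hab : Commute a b) (e e' : ℕ → ℕ) (A B : ℕ → W →+ W)
      (hA : ∀ m f, (p : W) ^ e m * A m f = (a ^ (p ^ e m)) f - f) (hB : ∀ m f, (p : W) ^ e' m * B m f = (b ^ (p ^ e' m)) f - f)
      (D D' : Derivation ℤ (RR W p) (RR W p)) (hD : ∀ f, D (cl p f) = cl p (fun m => A m (f m)))
      (hD' : ∀ f, D' (cl p f) = cl p (fun m => B m (f m))), ∀ x, D (D' x) = D' (D x) := by
    intro a b hab e e' A B hA hB D D' hD hD' x
    obtain ⟨f, rfl⟩ := cl_surj x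
    rw [hD', hD, hD, hD']
    congr 1
    funext m
    refine quot_comm (p ^ e m) (p ^ e' m) (by push_cast; exact hpm _) (by push_cast; exact hpm _)
      (hab.pow_pow (p ^ e m) (p ^ e' m)) ?_ ?_ (f m)
    · intro f; push_cast; exact hA m f
    · intro f; push_cast; exact hB m f
  have hbr : ∀ (a b : RingAut W) (h : a * b = c * b * a) (hca : Commute c a) (hcb : Commute c b) (A B : ℕ → W →+ W)
      (hA : ∀ m f, (p : W) ^ id m * A m f = (a ^ (p ^ id m)) f - f) (hB : ∀ m f, (p : W) ^ id m * B m f = (b ^ (p ^ id m)) f - f)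
      (D D' : Derivation ℤ (RR W p) (RR W p)) (hD : ∀ f, D (cl p f) = cl p (fun m => A m (f m)))
      (hD' : ∀ f, D' (cl p f) = cl p (fun m => B m (f m))), ∀ x, D (D' x) - D' (D x) = DZ x := by
    intro a b h hca hcb A B hA hB D D' hD hD' x
    obtain ⟨f, rfl⟩ := cl_surj x
    rw [hD', hD, hD, hD', eZ]
    have e : cl p (fun m => A m (B m (f m))) - cl p (fun m => B m (A m (f m))) =
      cl p (fun m => A m (B m (f m)) - B m (A m (f m))) := (map_sub (clHom p) _ _).symm
    rw [e, cl_eq]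
    intro k
    filter_upwards [UU_ge k] with m hm
    refine (pow_dvd_pow _ hm).trans ?_
    have := quot_bracket (W := W) (p ^ m) (by push_cast; exact hpm _) h hca hcb (A := A m) (B := B m) (Z := Z m)
      (fun f => by push_cast; exact hA m f) (fun f => by push_cast; exact hB m f)
      (fun f => by push_cast; rw [← pow_add, ← pow_add]; exact hZ m f) (f m)
    push_cast at this
    exact this
  have hZ0 : DZ = 0 := by
    refine lie_lemma DA1 DB1 DA2 DB2 DZ (cl p fun _ => s) (cl p fun _ => t) ?_
      (hbr a1 b1 h1 k1 k2 _ _ hA1 hB1 _ _ eA1 eB1) (hbr a2 b2 h2 k3 k4 _ _ hA2 hB2 _ _ eA2 eB2)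
      (hcomm _ _ k1.symm _ _ _ _ hA1 hZ _ _ eA1 eZ) (hcomm _ _ k2.symm _ _ _ _ hB1 hZ _ _ eB1 eZ)
      (hcomm _ _ k3.symm _ _ _ _ hA2 hZ _ _ eA2 eZ) (hcomm _ _ k4.symm _ _ _ _ hB2 hZ _ _ eB2 eZ)
      (hcomm _ _ l1 _ _ _ _ hA1 hA2 _ _ eA1 eA2) (hcomm _ _ l2 _ _ _ _ hA1 hB2 _ _ eA1 eB2)
      (hcomm _ _ l3 _ _ _ _ hB1 hA2 _ _ eB1 eA2) (hcomm _ _ l4 _ _ _ _ hB1 hB2 _ _ eB1 eB2)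
    intro D hD hs ht
    refine Rep_ker hR (Cst := Cst) ?_ hs ht
    have hle : Submodule.span (RR W p) {DA1, DB1, DA2, DB2, DZ} ≤ RepD p Cst := by
      rw [Submodule.span_le]
      intro x hx
      simp only [Set.mem_insert_iff, Set.mem_singleton_iff] at hx
      rcases hx with rfl | rfl | rfl | rfl | rfl
      · exact ⟨A1, adA1, eA1⟩
      · exact ⟨B1, adB1, eB1⟩
      · exact ⟨A2, adA2, eA2⟩
      · exact ⟨B2, adB2, eB2⟩
      · exact ⟨Z, adZ, eZ⟩
    exact hle hD
  -- contradiction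
  have hgrow : ∀ N : ℕ, (p : W) ^ (N + j + 1) ∣ (c ^ (p ^ N)) f0 - f0 - p ^ N * (c f0 - f0) := by
    intro N
    induction N with
    | zero => simp
    | succ N ih =>
      obtain ⟨w, hw⟩ := ih
      obtain ⟨v, hv⟩ := (pow_dvd_pow (p : W) (show N + 1 + j + 1 ≤ 2 * (j + N) by omega)).trans
        (cong_pow_lin (cong_pow (by omega) hj N) p f0)
      rw [← pow_mul, ← pow_succ] at hv
      refine ⟨v + w, ?_⟩
      linear_combination hv + p * hw
  have hz := eZ (fun _ => f0)
  rw [hZ0, Derivation.zero_apply] at hz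
  obtain ⟨m, hm⟩ := ((cl_eq_zero.mp hz.symm) (j + 1)).exists
  apply hf0
  obtain ⟨w, hw⟩ := hgrow (m + m)
  obtain ⟨v, hv⟩ := hm
  have e := hZ m f0
  rw [← e, hv] at hw
  refine ⟨v - w, ?_⟩
  apply mul_left_cancel₀ (hpm (m + m))
  linear_combination -hw
end PartE

section PartF
open Pointwise
variable {p : ℕ} [hp : Fact p.Prime] {O : Subring ℂ} {r : O →+* ZMod p} (b : Fin 2 → ZMod p)

variable (r) in
/-- embedding into the Gauss ring -/
def jW : MvPolynomial (Fin 2) O →+* VV r b :=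
  (jS b).codRestrict (VV r b) (fun N => (Res.map (e := eS r) N).mem)

lemma jW_val (N : MvPolynomial (Fin 2) O) : ((jW r b N : VV r b) : K2) = jS b N := rfl

lemma not_p_dvd {D : MvPolynomial (Fin 2) O} (hD : eS r D ≠ 0) : ¬ ((p : ℕ) : VV r b) ∣ jW r b D := by
  rintro ⟨v, hv⟩
  obtain ⟨w, hw⟩ := v.2
  have e : jS b D = (p : K2) * v := by
    have := congrArg Subtype.val hv
    rw [jW_val] at this
    rw [this]; push_cast; rfl
  have h := (res_p (r := r) b).mul hw
  rw [← e, zero_mul] at h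
  exact hD ((Res.map D).unique (jS_inj O b) h)

variable (r) in
/-- constants -/
def Cst : Set (VV r b) := Set.range fun c : O => jW r b (C c)

lemma rigid_VV (h1 : ∀ z : O, r z = 0 → ∃ w : O, z = p * w) :
    Rigid p (Cst r b) (jW r b (X 0)) (jW r b (X 1)) := by
  intro D k hL hC hs ht
  have hN : ∀ N, ((p : ℕ) : VV r b) ^ k ∣ D (jW r b N) := by
    intro N
    induction N using MvPolynomial.induction_on with
    | C c => exact hC _ ⟨c, rfl⟩
    | add P Q hP hQ => rw [map_add, map_add]; exact dvd_add hP hQ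
    | mul_X P i hP =>
      rw [map_mul]
      have hi : ((p : ℕ) : VV r b) ^ k ∣ D (jW r b (X i)) := by
        fin_cases i
        · exact hs
        · exact ht
      exact (dvd_iff_dvd_of_dvd_sub (hL _ _)).mpr (dvd_add (dvd_mul_of_dvd_right hi _) (dvd_mul_of_dvd_right hP _))
  intro f
  obtain ⟨w, N, Q, hQ, hf, -⟩ := f.2
  have e : f * jW r b Q = jW r b N := Subtype.ext hf
  have h2 := hL f (jW r b Q)
  rw [e] at h2
  have h3 := (dvd_iff_dvd_of_dvd_sub h2).mp (hN N)
  have h4 := (dvd_add_right (dvd_mul_of_dvd_right (hN Q) f)).mp h3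
  exact (prime_p b h1).pow_dvd_of_dvd_mul_left k (not_p_dvd b hQ) h4

variable (r) in
/-- stabilizer of the Gauss ring -/
def HH : Subgroup Cremona where
  carrier := {τ | ∀ f, τ f ∈ VV r b ↔ f ∈ VV r b}
  mul_mem' := fun {σ τ} hσ hτ f => (hσ (τ f)).trans (hτ f)
  one_mem' := fun f => Iff.rfl
  inv_mem' := fun {τ} hτ f => by
    have := hτ (τ⁻¹ f)
    rw [← AlgEquiv.mul_apply, mul_inv_cancel, AlgEquiv.one_apply] at this
    exact this.symm

lemma mem_HH {τ : Cremona} : τ ∈ HH r b ↔ ∀ f, τ f ∈ VV r b ↔ f ∈ VV r b := Iff.rfl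

variable (r) in
/-- action on the Gauss ring -/
def rho : HH r b →* RingAut (VV r b) where
  toFun τ :=
    { toFun := fun f => ⟨τ.1 f, (τ.2 f).mpr f.2⟩
      invFun := fun f => ⟨τ⁻¹.1 f, (τ⁻¹.2 f).mpr f.2⟩
      left_inv := fun f => Subtype.ext (by
        change (τ.1⁻¹ * τ.1) (f : K2) = f
        rw [inv_mul_cancel]; rfl)
      right_inv := fun f => Subtype.ext (by
        change (τ.1 * τ.1⁻¹) (f : K2) = f
        rw [mul_inv_cancel]; rfl)
      map_mul' := fun f g => Subtype.ext (map_mul τ.1 _ _)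
      map_add' := fun f g => Subtype.ext (map_add τ.1 _ _) }
  map_one' := rfl
  map_mul' := fun σ τ => rfl

lemma rho_val (τ : HH r b) (f : VV r b) : ((rho r b τ f : VV r b) : K2) = τ.1 f := rfl

lemma rho_Cst (τ : HH r b) : ∀ x ∈ Cst r b, rho r b τ x = x := by
  rintro _ ⟨c, rfl⟩
  apply Subtype.ext
  rw [rho_val]
  change τ.1 (jS b (C c)) = jS b (C c)
  rw [jS_C]; exact τ.1.commutes _

lemma crem_ext (τ : Cremona) (h : ∀ i, τ (jO O (X i)) = jO O (X i)) : τ = 1 := by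
  have hN : ∀ N : MvPolynomial (Fin 2) ℂ, τ (algebraMap _ K2 N) = algebraMap _ K2 N := by
    intro N
    induction N using MvPolynomial.induction_on with
    | C c =>
      have : (algebraMap (MvPolynomial (Fin 2) ℂ) K2 (C c)) = algebraMap ℂ K2 c :=
        (IsScalarTower.algebraMap_apply ℂ (MvPolynomial (Fin 2) ℂ) K2 c).symm
      rw [this]; exact τ.commutes _
    | add P Q hP hQ => rw [map_add, map_add, hP, hQ]
    | mul_X P i hP =>
      have := h i
      simp only [jO, RingHom.comp_apply, map_X] at this
      rw [map_mul, map_mul, hP, this]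
  ext f
  obtain ⟨x, y, hy, rfl⟩ := IsFractionRing.div_surjective (A := MvPolynomial (Fin 2) ℂ) f
  rw [map_div₀, hN, hN]; rfl

lemma rho_inj (τ : HH r b) (h : rho r b τ = 1) : τ.1 = 1 := by
  apply crem_ext (O := O)
  intro i
  have h1 : τ.1 (jS (O := O) b (X i)) = jS (O := O) b (X i) := by
    have := congrArg Subtype.val (DFunLike.congr_fun h (jW r b (X i)))
    exact this
  have h2 : jO O (X i) = p * jS (O := O) b (X i) + ((b i).val : K2) := by rw [jS_X]; ring
  rw [h2, map_add, map_mul, map_natCast, map_natCast, h1]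

lemma pow_HH (h1 : ∀ z : O, r z = 0 → ∃ w : O, z = p * w) (u : Cremona)
    (hu : ∃ d : ℕ, 0 < d ∧ u ^ d • LL r b = LL r b) :
    ∃ n : ℕ, 0 < n ∧ ∃ h : u ^ n ∈ HH r b, CongW p 1 (rho r b ⟨u ^ n, h⟩) := by
  obtain ⟨d, hd, hu⟩ := hu
  obtain ⟨n, hn, h, h'⟩ := cong_exists b h1 _ hu
  rw [← pow_mul] at h h'
  refine ⟨d * n, Nat.mul_pos hd hn, ?_, ?_⟩
  · intro f
    constructor
    · intro hf
      have := h' _ hf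
      rwa [← AlgEquiv.mul_apply, inv_mul_cancel] at this
    · intro hf
      obtain ⟨v, hv, e⟩ := h f hf
      have : (u ^ (d * n)) f = f + p * v := by linear_combination e
      rw [this]
      exact add_mem hf (mul_mem (natCast_mem _ _) hv)
  · intro f
    obtain ⟨v, hv, e⟩ := h f f.2
    refine ⟨⟨v, hv⟩, Subtype.ext ?_⟩
    push_cast
    rw [pow_one]; exact e

lemma cong_mul {u : Cremona} {n : ℕ} (h : u ^ n ∈ HH r b) (hc : CongW p 1 (rho r b ⟨u ^ n, h⟩)) {N : ℕ} (hN : n * p ∣ N) :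
    ∃ x : HH r b, x.1 = u ^ N ∧ CongW p 2 (rho r b x) := by
  obtain ⟨k, rfl⟩ := hN
  refine ⟨(⟨u ^ n, h⟩ ^ p) ^ k, ?_, ?_⟩
  · simp [pow_mul]
  · rw [map_pow, map_pow]
    exact (cong_pow_p le_rfl hc).pow k

lemma core_conc (h1 : ∀ z : O, r z = 0 → ∃ w : O, z = p * w)
    (h2 : ∀ z : O, (∀ k : ℕ, ∃ w : O, z = p ^ k * w) → z = 0) (a1 b1 a2 b2 c : Cremona)
    (ha1 : ∃ d : ℕ, 0 < d ∧ a1 ^ d • LL r b = LL r b) (hb1 : ∃ d : ℕ, 0 < d ∧ b1 ^ d • LL r b = LL r b)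
    (ha2 : ∃ d : ℕ, 0 < d ∧ a2 ^ d • LL r b = LL r b) (hb2 : ∃ d : ℕ, 0 < d ∧ b2 ^ d • LL r b = LL r b)
    (r1 : a1 * b1 = c * b1 * a1) (r2 : a2 * b2 = c * b2 * a2)
    (k1 : Commute c a1) (k2 : Commute c b1) (k3 : Commute c a2) (k4 : Commute c b2)
    (l1 : Commute a1 a2) (l2 : Commute a1 b2) (l3 : Commute b1 a2) (l4 : Commute b1 b2) :
    ∃ k : ℕ, 0 < k ∧ c ^ k = 1 := by
  obtain ⟨n1, m1, q1, w1⟩ := pow_HH b h1 a1 ha1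
  obtain ⟨n2, m2, q2, w2⟩ := pow_HH b h1 b1 hb1
  obtain ⟨n3, m3, q3, w3⟩ := pow_HH b h1 a2 ha2
  obtain ⟨n4, m4, q4, w4⟩ := pow_HH b h1 b2 hb2
  let N := n1 * n2 * n3 * n4 * p
  have hp0 : 0 < p := hp.out.pos
  have hN : 0 < N := by positivity
  obtain ⟨A1, e1, v1⟩ := cong_mul b q1 w1 (N := N) ⟨n2 * n3 * n4, by ring⟩
  obtain ⟨B1, e2, v2⟩ := cong_mul b q2 w2 (N := N) ⟨n1 * n3 * n4, by ring⟩
  obtain ⟨A2, e3, v3⟩ := cong_mul b q3 w3 (N := N) ⟨n1 * n2 * n4, by ring⟩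
  obtain ⟨B2, e4, v4⟩ := cong_mul b q4 w4 (N := N) ⟨n1 * n2 * n3, by ring⟩
  refine ⟨N * N, Nat.mul_pos hN hN, ?_⟩
  have R1 := comm_pow_aux r1 k1 k2 N N
  have R2 := comm_pow_aux r2 k3 k4 N N
  rw [← e1, ← e2] at R1
  rw [← e3, ← e4] at R2
  have hCm : c ^ (N * N) ∈ HH r b := by
    have : c ^ (N * N) = ((A1 * B1) * (B1 * A1)⁻¹ : HH r b).1 := by
      change _ = (A1.1 * B1.1) * (B1.1 * A1.1)⁻¹
      rw [R1]; group
    rw [this]; exact Subtype.property _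
  let c' : HH r b := ⟨c ^ (N * N), hCm⟩
  have S1 : A1 * B1 = c' * B1 * A1 := Subtype.ext R1
  have S2 : A2 * B2 = c' * B2 * A2 := Subtype.ext R2
  have cm : ∀ (x y : HH r b) (u v : Cremona) (m n : ℕ), x.1 = u ^ m → y.1 = v ^ n → Commute u v → Commute (rho r b x) (rho r b y) := by
    intro x y u v m n hx hy huv
    have : Commute x y := Subtype.ext (by
      change x.1 * y.1 = y.1 * x.1
      rw [hx, hy]; exact huv.pow_pow m n)
    exact this.map (rho r b)
  have T1 : rho r b A1 * rho r b B1 = rho r b c' * rho r b B1 * rho r b A1 := by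
    rw [← map_mul, S1, map_mul, map_mul]
  have T2 : rho r b A2 * rho r b B2 = rho r b c' * rho r b B2 * rho r b A2 := by
    rw [← map_mul, S2, map_mul, map_mul]
  have cc : CongW p 2 (rho r b c') := by
    intro f
    obtain ⟨g, rfl⟩ := (rho r b B1 * rho r b A1).surjective f
    have e : rho r b c' ((rho r b B1 * rho r b A1) g) = (rho r b A1 * rho r b B1) g := by
      rw [T1]; rfl
    rw [e, RingAut.mul_apply, RingAut.mul_apply]
    have z := dvd_sub (dvd_add (v1 (rho r b B1 g)) (v2 g)) (dvd_add (v2 (rho r b A1 g)) (v1 g))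
    convert z using 1
    ring
  have := core_abs (prime_p b h1) (sep_VV b h1 h2) (Cst r b) _ _ (rigid_VV b h1)
    (rho r b A1) (rho r b B1) (rho r b A2) (rho r b B2) (rho r b c')
    (rho_Cst b _) (rho_Cst b _) (rho_Cst b _) (rho_Cst b _) (rho_Cst b _)
    (v1.mono (by omega)) (v2.mono (by omega)) (v3.mono (by omega)) (v4.mono (by omega)) cc T1 T2
    (cm _ _ _ _ _ _ rfl e1 k1) (cm _ _ _ _ _ _ rfl e2 k2) (cm _ _ _ _ _ _ rfl e3 k3) (cm _ _ _ _ _ _ rfl e4 k4)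
    (cm _ _ _ _ _ _ e1 e3 l1) (cm _ _ _ _ _ _ e1 e4 l2) (cm _ _ _ _ _ _ e2 e3 l3) (cm _ _ _ _ _ _ e2 e4 l4)
  exact rho_inj b c' this

end PartF

section Final
open Pointwise

theorem final_thm (n : ℕ) (hn : 4 ≤ n) (Γ : Subgroup (Matrix.SpecialLinearGroup (Fin n) ℤ)) (hΓ : Γ.FiniteIndex)
    (ι : Γ →* Cremona) : ¬ Function.Injective ι := by
  intro hι
  obtain ⟨E, m, hm, hadd, hcom, hcm, hne⟩ := group_data n Γ hΓ ι hι
  let i0 : Fin n := ⟨0, by omega⟩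
  let i1 : Fin n := ⟨1, by omega⟩
  let i2 : Fin n := ⟨2, by omega⟩
  let i3 : Fin n := ⟨3, by omega⟩
  have d01 : i0 ≠ i1 := by simp [i0, i1]
  have d02 : i0 ≠ i2 := by simp [i0, i2]
  have d03 : i0 ≠ i3 := by simp [i0, i3]
  have d12 : i1 ≠ i2 := by simp [i1, i2]
  have d13 : i1 ≠ i3 := by simp [i1, i3]
  have d23 : i2 ≠ i3 := by simp [i2, i3]
  have hI : ∀ i j : Fin n, ∃ k, i ≠ k ∧ k ≠ j := by
    intro i j
    by_contra hcon
    push Not at hcon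
    by_cases h0 : i = i0
    · have a := hcon i1 (by rw [h0]; exact d01)
      have c := hcon i2 (by rw [h0]; exact d02)
      exact d12 (a.trans c.symm)
    · by_cases h1 : i = i1
      · have a := hcon i0 (by rw [h1]; exact d01.symm)
        have c := hcon i2 (by rw [h1]; exact d12)
        exact d02 (a.trans c.symm)
      · exact d01 ((hcon i0 h0).trans (hcon i1 h1).symm)
  obtain ⟨p, hp, O, r, h1, h2, b, hb⟩ := fixed_point E m hadd (by
      intro i k j hik hkj hij s t
      rw [hcom i k j hik hkj hij]; group) hI {(i0, i1), (i1, i3), (i0, i2), (i2, i3)}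
      Finset.card_le_four (by
        intro x hx
        simp only [Finset.mem_insert, Finset.mem_singleton] at hx
        rcases hx with rfl | rfl | rfl | rfl <;> assumption)
  obtain ⟨k, hk, hck⟩ := core_conc b h1 h2 (E i0 i1 (m ^ 3)) (E i1 i3 (m ^ 3)) (E i0 i2 (m ^ 3)) (E i2 i3 (m ^ 3))
    (E i0 i3 (m * m ^ 3 * m ^ 3)) (hb (i0, i1) (by simp)) (hb (i1, i3) (by simp)) (hb (i0, i2) (by simp))
    (hb (i2, i3) (by simp)) (hcom _ _ _ d01 d13 d03 _ _) (hcom _ _ _ d02 d23 d03 _ _)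
    (hcm _ _ _ _ d03 d01 d03.symm d01 _ _) (hcm _ _ _ _ d03 d13 d13.symm d03 _ _)
    (hcm _ _ _ _ d03 d02 d03.symm d02 _ _) (hcm _ _ _ _ d03 d23 d23.symm d03 _ _)
    (hcm _ _ _ _ d01 d02 d01.symm d02 _ _) (hcm _ _ _ _ d01 d23 d12 d03 _ _)
    (hcm _ _ _ _ d13 d02 d03.symm d12 _ _) (hcm _ _ _ _ d13 d23 d23.symm d13 _ _)
  rw [← E_pow E hadd i0 i3 d03] at hck
  refine hne i0 i3 d03 _ ?_ hck
  have : (k : ℤ) ≠ 0 := by exact_mod_cast hk.ne'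
  positivity
end Final

/-- For `n ≥ 4`, no finite-index subgroup of `SL_n(ℤ)` embeds into the Cremona
group. -/
theorem sln_does_not_embed_in_cremona (n : ℕ) (hn : 4 ≤ n)
    (Γ : Subgroup (Matrix.SpecialLinearGroup (Fin n) ℤ)) (hΓ : Γ.FiniteIndex)
    (ι : Γ →* Cremona) : ¬ Function.Injective ι := by
  exact final_thm n hn Γ hΓ ι
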